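/- arXiv:2506.09165 — 2 statements merged into one kernel-verified Lean document; each statement's English description precedes it below -/
import Mathlib

section
/- Fix q > 0 and L > 0. There exist constants c > 0 and C > 0 depending only on L and q such that for all integers m ≥ 1, d ≥ 1 and all n ≥ 2, the minimax risk for the mixture class G^{(m,d)}_{F_{L,q}} under squared total variation distance satisfies c · (n log n)^{−2q/(2q+1)} ≤ inf_{f̂} sup_{f ∈ G} E[TV(f̂(X₁,…,X_n), f)²] ≤ C · m^{2q/(2q+1)} · d^{(2q+2)/(2q+1)} · n^{−2q/(2q+1)}, where the infimum is over all measurable estimators f̂ mapping a sample (X₁,…,X_n) ∈ ([0,1]^d)^n to a probability density on [0,1]^d, the supremum is over f ∈ G^{(m,d)}_{F_{L,q}}, and the expectation is over X₁,…,X_n drawn i.i.d. from the distribution on [0,1]^d with density f. -/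
open MeasureTheory
open scoped ENNReal

/-- The unit cube `[0,1]^d`. -/
def unitCube (d : ℕ) : Set (Fin d → ℝ) :=
  Set.univ.pi fun _ => Set.Icc (0 : ℝ) 1

/-- For `q > 0`, the integer part `l` in the decomposition `q = l + β` with `β ∈ (0,1]`. -/
noncomputable def holderInt (q : ℝ) : ℕ := ⌈q⌉₊ - 1

/-- The class `F_{L,q}` of `q`-Hölder smooth probability densities on `[0,1]`:
nonnegative, integrating to one, `l`-times continuously differentiable on `[0,1]`, with the
`l`-th derivative `β`-Hölder continuous with constant `L`, where `q = l + β`, `β ∈ (0,1]`. -/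
noncomputable def HolderClass (L q : ℝ) : Set (ℝ → ℝ) :=
  {f | (∀ x ∈ Set.Icc (0 : ℝ) 1, 0 ≤ f x) ∧
    (∫ x in Set.Icc (0 : ℝ) 1, f x) = 1 ∧
    ContDiffOn ℝ (holderInt q) f (Set.Icc (0 : ℝ) 1) ∧
    ∀ x ∈ Set.Icc (0 : ℝ) 1, ∀ y ∈ Set.Icc (0 : ℝ) 1,
      |iteratedDerivWithin (holderInt q) f (Set.Icc (0 : ℝ) 1) x -
        iteratedDerivWithin (holderInt q) f (Set.Icc (0 : ℝ) 1) y| ≤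
        L * |x - y| ^ (q - holderInt q)}

/-- The class `G^{(m,d)}_{F_{L,q}}` of `m`-component mixtures of products of densities
from `F_{L,q}`. -/
noncomputable def MixtureClass (L q : ℝ) (m d : ℕ) : Set ((Fin d → ℝ) → ℝ) :=
  {g | ∃ (π : Fin m → ℝ) (f : Fin m → Fin d → ℝ → ℝ),
    (∀ k, 0 ≤ π k) ∧ (∑ k, π k = 1) ∧ (∀ k j, f k j ∈ HolderClass L q) ∧
    g = fun x => ∑ k, π k * ∏ j, f k j (x j)}

/-- The Hellinger distance between densities on `[0,1]^d`. -/
noncomputable def hellingerDist {d : ℕ} (p q : (Fin d → ℝ) → ℝ) : ℝ :=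
  Real.sqrt (∫ x in unitCube d, (Real.sqrt (p x) - Real.sqrt (q x)) ^ 2)

/-- The total variation distance between densities on `[0,1]^d`. -/
noncomputable def tvDist {d : ℕ} (p q : (Fin d → ℝ) → ℝ) : ℝ :=
  (1 / 2) * ∫ x in unitCube d, |p x - q x|

/-- A probability density on the unit cube `[0,1]^d`. -/
def IsDensityOnCube {d : ℕ} (g : (Fin d → ℝ) → ℝ) : Prop :=
  (∀ x ∈ unitCube d, 0 ≤ g x) ∧ (∫ x in unitCube d, g x) = 1

/-- The probability measure on `[0,1]^d` with density `f`. -/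
noncomputable def densityMeasure {d : ℕ} (f : (Fin d → ℝ) → ℝ) : Measure (Fin d → ℝ) :=
  (volume.restrict (unitCube d)).withDensity fun x => ENNReal.ofReal (f x)

/-- The distribution of an i.i.d. sample of size `n` from the density `f` on `[0,1]^d`. -/
noncomputable def sampleMeasure {d : ℕ} (n : ℕ) (f : (Fin d → ℝ) → ℝ) :
    Measure (Fin n → Fin d → ℝ) :=
  Measure.pi fun _ : Fin n => densityMeasure f

/-- The minimax risk over `G^{(m,d)}_{F_{L,q}}` for the (squared) loss `ρ²`: the infimum
over measurable estimators producing probability densities on `[0,1]^d` of the worst-case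
expected squared loss. -/
noncomputable def minimaxRisk (L q : ℝ) (m d n : ℕ)
    (ρ : ((Fin d → ℝ) → ℝ) → ((Fin d → ℝ) → ℝ) → ℝ) : ℝ≥0∞ :=
  ⨅ (est : (Fin n → Fin d → ℝ) → (Fin d → ℝ) → ℝ)
    (_ : Measurable fun p : (Fin n → Fin d → ℝ) × (Fin d → ℝ) => est p.1 p.2)
    (_ : ∀ s, IsDensityOnCube (est s)),
    ⨆ f ∈ MixtureClass L q m d,
      ∫⁻ s, ENNReal.ofReal (ρ (est s) f ^ 2) ∂(sampleMeasure n f)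

/-- Taylor's formula with a Hölder remainder, for a chain of derivatives on `[0,1]`. -/
theorem abs_sub_taylorSum_le {l : ℕ} {L β : ℝ} (hL : 0 ≤ L) (hβ : 0 < β) {F : ℕ → ℝ → ℝ}
    (hF : ∀ k < l, ∀ x ∈ Set.Icc (0 : ℝ) 1,
      HasDerivWithinAt (F k) (F (k + 1) x) (Set.Icc 0 1) x)
    (hH : ∀ x ∈ Set.Icc (0 : ℝ) 1, ∀ y ∈ Set.Icc (0 : ℝ) 1,
      |F l x - F l y| ≤ L * |x - y| ^ β) (i : ℕ) :
    ∀ k, k + i = l → ∀ x ∈ Set.Icc (0 : ℝ) 1, ∀ y ∈ Set.Icc (0 : ℝ) 1, x ≤ y →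
      |F k y - ∑ j ∈ Finset.range (i + 1), F (k + j) x * (y - x) ^ j / (j.factorial : ℝ)| ≤
        L * (y - x) ^ (β + i) := by
  induction i with
  | zero =>
    intro k hk x hx y hy hxy
    obtain rfl : k = l := by simpa using hk
    have := hH y hy x hx
    rw [abs_of_nonneg (sub_nonneg.2 hxy)] at this
    simpa using this
  | succ i ih =>
    intro k hk x hx y hy hxy
    set φ : ℝ → ℝ := fun z =>
      F k z - ∑ j ∈ Finset.range (i + 1 + 1), F (k + j) x * (z - x) ^ j / (j.factorial : ℝ)
      with hφ
    have hsub : Set.Icc x y ⊆ Set.Icc 0 1 := Set.Icc_subset_Icc hx.1 hy.2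
    have hder : ∀ z ∈ Set.Icc x y, HasDerivWithinAt φ
        (F (k + 1) z - ∑ j ∈ Finset.range (i + 1),
          F (k + 1 + j) x * (z - x) ^ j / (j.factorial : ℝ)) (Set.Icc x y) z := by
      intro z hz
      refine ((hF k (by omega) z (hsub hz)).mono hsub).sub ?_
      have hterm : ∀ j ∈ Finset.range (i + 1 + 1), HasDerivWithinAt
          (fun z => F (k + j) x * (z - x) ^ j / (j.factorial : ℝ))
          (F (k + j) x * (j * (z - x) ^ (j - 1)) / (j.factorial : ℝ)) (Set.Icc x y) z := by
        intro j _
        have := (((hasDerivAt_id z).sub_const x).pow j).hasDerivWithinAt (s := Set.Icc x y)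
        simpa using (this.const_mul (F (k + j) x)).div_const (j.factorial : ℝ)
      have hsum := HasDerivWithinAt.fun_sum hterm
      refine hsum.congr_deriv ?_
      rw [Finset.sum_range_succ']
      simp only [Nat.cast_zero, zero_mul, mul_zero, zero_div, add_zero]
      refine Finset.sum_congr rfl fun j _ => ?_
      rw [Nat.factorial_succ, show k + (j + 1) = k + 1 + j by ring, Nat.add_sub_cancel]
      push_cast
      field_simp
    have hbound : ∀ z ∈ Set.Icc x y, ‖F (k + 1) z - ∑ j ∈ Finset.range (i + 1),
          F (k + 1 + j) x * (z - x) ^ j / (j.factorial : ℝ)‖ ≤ L * (y - x) ^ (β + i) := by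
      intro z hz
      refine (ih (k + 1) (by omega) x hx z (hsub hz) hz.1).trans ?_
      have h1 : z - x ≤ y - x := by linarith [hz.2]
      have h0 : 0 ≤ z - x := by linarith [hz.1]
      gcongr
    have key := Convex.norm_image_sub_le_of_norm_hasDerivWithin_le hder hbound
      (convex_Icc x y) (Set.left_mem_Icc.2 hxy) (Set.right_mem_Icc.2 hxy)
    have hφx : φ x = 0 := by
      simp only [hφ]
      rw [Finset.sum_range_succ']
      simp
    rw [hφx, sub_zero, Real.norm_eq_abs, Real.norm_eq_abs,
      abs_of_nonneg (sub_nonneg.2 hxy)] at key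
    refine key.trans (le_of_eq ?_)
    have h0 : 0 ≤ y - x := sub_nonneg.2 hxy
    rw [show β + ((i + 1 : ℕ) : ℝ) = (β + i) + 1 by push_cast; ring,
      Real.rpow_add_one' h0 (by positivity), mul_assoc]

/-- The coefficients of a polynomial are controlled by its `L¹` norm on `[0,1]`. -/
theorem exists_coeff_bound (l : ℕ) : ∃ K : ℝ, 0 < K ∧ ∀ a : Fin (l + 1) → ℝ,
    ∀ k, |a k| ≤ K * ∫ x in Set.Icc (0 : ℝ) 1, |∑ j, a j * x ^ (j : ℕ)| := by
  classical
  have hg_int : ∀ g : ℝ → ℝ, Continuous g → IntegrableOn g (Set.Icc 0 1) := fun g hg =>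
    hg.continuousOn.integrableOn_compact isCompact_Icc
  let T : (Fin (l + 1) → ℝ) →ₗ[ℝ] (Fin (l + 1) → ℝ) :=
    { toFun := fun a i => ∫ x in Set.Icc (0 : ℝ) 1, x ^ (i : ℕ) * ∑ j, a j * x ^ (j : ℕ)
      map_add' := by
        intro a b
        funext i
        simp only [Pi.add_apply]
        rw [← integral_add (hg_int _ (by fun_prop)) (hg_int _ (by fun_prop))]
        congr 1
        funext x
        simp only [add_mul, Finset.sum_add_distrib, mul_add]
      map_smul' := by
        intro c a
        funext i
        simp only [Pi.smul_apply, smul_eq_mul, RingHom.id_apply]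
        rw [← integral_const_mul]
        congr 1
        funext x
        simp only [Finset.mul_sum]
        refine Finset.sum_congr rfl fun j _ => by ring }
  have hker : T.ker = ⊥ := by
    rw [LinearMap.ker_eq_bot']
    intro a ha
    have hcont : Continuous fun x : ℝ => ∑ j, a j * x ^ (j : ℕ) := by fun_prop
    have hsq : ∫ x in Set.Icc (0 : ℝ) 1, (∑ j, a j * x ^ (j : ℕ)) ^ 2 = 0 := by
      have : ∀ x : ℝ, (∑ j, a j * x ^ (j : ℕ)) ^ 2 =
          ∑ i, a i * (x ^ (i : ℕ) * ∑ j, a j * x ^ (j : ℕ)) := by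
        intro x
        rw [sq, Finset.sum_mul]
        refine Finset.sum_congr rfl fun j _ => by ring
      simp_rw [this]
      rw [integral_finsetSum _ fun i _ => hg_int _ (by fun_prop)]
      refine Finset.sum_eq_zero fun i _ => ?_
      rw [integral_const_mul]
      have := congrFun ha i
      simp only [T, LinearMap.coe_mk, AddHom.coe_mk, Pi.zero_apply] at this
      rw [this, mul_zero]
    have hzero : ∀ x ∈ Set.Ioo (0 : ℝ) 1, ∑ j, a j * x ^ (j : ℕ) = 0 := by
      rw [integral_Icc_eq_integral_Ioo] at hsq
      have hae := (setIntegral_eq_zero_iff_of_nonneg_ae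
        (Filter.Eventually.of_forall fun x => sq_nonneg _)
        ((hg_int _ (hcont.pow 2)).mono_set Set.Ioo_subset_Icc_self)).1 hsq
      have := Measure.eqOn_open_of_ae_eq hae isOpen_Ioo
        (hcont.pow 2).continuousOn continuousOn_const
      intro x hx
      simpa using this hx
    let p : Polynomial ℝ := ∑ j : Fin (l + 1), Polynomial.C (a j) * Polynomial.X ^ (j : ℕ)
    have hp : p = 0 := by
      refine Polynomial.eq_zero_of_infinite_isRoot p ?_
      refine (Set.Ioo_infinite (zero_lt_one' ℝ)).mono fun x hx => ?_
      simpa [p, Polynomial.IsRoot, Polynomial.eval_finsetSum] using hzero x hx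
    funext k
    have := congrArg (fun r => Polynomial.coeff r (k : ℕ)) hp
    simpa [p, Polynomial.finsetSum_coeff, Polynomial.coeff_X_pow, Fin.val_inj] using this
  obtain ⟨K, hK, hanti⟩ := T.exists_antilipschitzWith hker
  refine ⟨K, by exact_mod_cast hK, fun a k => ?_⟩
  have h1 : |a k| ≤ ‖a‖ := norm_le_pi_norm a k
  have h2 : ‖a‖ ≤ K * ‖T a‖ := by
    simpa using hanti.le_mul_dist a 0
  refine h1.trans (h2.trans ?_)
  gcongr
  rw [pi_norm_le_iff_of_nonneg (integral_nonneg fun x => abs_nonneg _)]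
  intro i
  refine (norm_integral_le_integral_norm _).trans ?_
  refine setIntegral_mono_on (hg_int _ (by fun_prop)) (hg_int _ (by fun_prop)) measurableSet_Icc ?_
  intro x hx
  rw [norm_mul, Real.norm_eq_abs, Real.norm_eq_abs, abs_of_nonneg (pow_nonneg hx.1 _)]
  exact mul_le_of_le_one_left (abs_nonneg _) (pow_le_one₀ hx.1 hx.2)

theorem holderInt_add_one {q : ℝ} (hq : 0 < q) : holderInt q + 1 = ⌈q⌉₊ := by
  have := Nat.ceil_pos.2 hq
  unfold holderInt
  omega

theorem holderInt_lt {q : ℝ} (hq : 0 < q) : (holderInt q : ℝ) < q := by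
  refine Nat.lt_ceil.1 ?_
  rw [← holderInt_add_one hq]
  exact Nat.lt_succ_self _

theorem le_holderInt_add_one {q : ℝ} (hq : 0 < q) : q ≤ holderInt q + 1 := by
  have := Nat.le_ceil q
  rw [← holderInt_add_one hq] at this
  exact_mod_cast this

namespace HolderClass

variable {L q : ℝ}

/-- The `k`-th derivative on `[0,1]`. -/
noncomputable def D (f : ℝ → ℝ) (k : ℕ) : ℝ → ℝ := iteratedDerivWithin k f (Set.Icc 0 1)

theorem hasDerivWithinAt_D {f : ℝ → ℝ} (hf : f ∈ HolderClass L q) :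
    ∀ k < holderInt q, ∀ x ∈ Set.Icc (0 : ℝ) 1,
      HasDerivWithinAt (D f k) (D f (k + 1) x) (Set.Icc 0 1) x := by
  intro k hk x hx
  have hd := (hf.2.2.1.differentiableOn_iteratedDerivWithin (m := k) (by exact_mod_cast hk)
    (uniqueDiffOn_Icc zero_lt_one)) x hx
  have := hd.hasDerivWithinAt
  rw [← iteratedDerivWithin_succ] at this
  exact this

theorem taylor (hq : 0 < q) (hL : 0 ≤ L) {f : ℝ → ℝ} (hf : f ∈ HolderClass L q) {k : ℕ}
    (hk : k ≤ holderInt q) {x y : ℝ} (hx : x ∈ Set.Icc (0 : ℝ) 1) (hy : y ∈ Set.Icc (0 : ℝ) 1)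
    (hxy : x ≤ y) :
    |D f k y - ∑ j ∈ Finset.range (holderInt q - k + 1),
        D f (k + j) x * (y - x) ^ j / (j.factorial : ℝ)| ≤ L * (y - x) ^ (q - k) := by
  have := abs_sub_taylorSum_le hL (sub_pos.2 (holderInt_lt hq)) (hasDerivWithinAt_D hf) hf.2.2.2
    (holderInt q - k) k (by omega) x hx y hy hxy
  rw [Nat.cast_sub hk] at this
  rwa [show q - k = q - holderInt q + (holderInt q - k) by ring]

theorem continuousOn {f : ℝ → ℝ} (hf : f ∈ HolderClass L q) :
    ContinuousOn f (Set.Icc 0 1) := hf.2.2.1.continuousOn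

theorem integrableOn {f : ℝ → ℝ} (hf : f ∈ HolderClass L q) :
    IntegrableOn f (Set.Icc 0 1) := (continuousOn hf).integrableOn_compact isCompact_Icc

/-- The derivatives at `0` are bounded uniformly over the Hölder class. -/
theorem exists_D_zero_bound (hq : 0 < q) (hL : 0 ≤ L) :
    ∃ B : ℝ, 0 < B ∧ ∀ f ∈ HolderClass L q, ∀ k ≤ holderInt q, |D f k 0| ≤ B := by
  obtain ⟨K, hK, hcoeff⟩ := exists_coeff_bound (holderInt q)
  refine ⟨(holderInt q).factorial * (K * (1 + L)), by positivity, fun f hf k hk => ?_⟩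
  set a : Fin (holderInt q + 1) → ℝ := fun j => D f j 0 / ((j : ℕ).factorial : ℝ) with ha
  have h0 : (0 : ℝ) ∈ Set.Icc (0 : ℝ) 1 := by simp
  have hpoly : ∀ y ∈ Set.Icc (0 : ℝ) 1, |∑ j, a j * y ^ (j : ℕ)| ≤ f y + L := by
    intro y hy
    have ht := taylor hq hL hf (Nat.zero_le _) h0 hy hy.1
    have hsum : ∑ j ∈ Finset.range (holderInt q - 0 + 1),
        D f (0 + j) 0 * (y - 0) ^ j / (j.factorial : ℝ) = ∑ j, a j * y ^ (j : ℕ) := by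
      rw [Nat.sub_zero, Finset.sum_range]
      refine Finset.sum_congr rfl fun j _ => ?_
      simp only [ha, zero_add, sub_zero]
      ring
    have hD0 : D f 0 y = f y := by simp [D]
    rw [hsum, hD0] at ht
    have h1 : L * (y - 0) ^ (q - (0 : ℕ)) ≤ L := by
      refine mul_le_of_le_one_right hL ?_
      simpa using Real.rpow_le_one hy.1 hy.2 hq.le
    have hfy := hf.1 y hy
    rw [abs_le] at ht ⊢
    constructor <;> linarith [ht.1, ht.2]
  have hg_int : ∫ x in Set.Icc (0 : ℝ) 1, |∑ j, a j * x ^ (j : ℕ)| ≤ 1 + L := by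
    have hc : IntegrableOn (fun _ : ℝ => L) (Set.Icc (0 : ℝ) 1) := integrableOn_const (by simp)
    have hcont : Continuous fun x : ℝ => |∑ j, a j * x ^ (j : ℕ)| := by fun_prop
    calc _ ≤ ∫ x in Set.Icc (0 : ℝ) 1, (f x + L) :=
          setIntegral_mono_on (hcont.continuousOn.integrableOn_compact isCompact_Icc)
            ((integrableOn hf).add hc) measurableSet_Icc hpoly
      _ = 1 + L := by
          rw [integral_add (integrableOn hf) hc, hf.2.1]
          simp
  have hk' := hcoeff a ⟨k, by omega⟩
  have h2 : |a ⟨k, by omega⟩| ≤ K * (1 + L) := hk'.trans (by gcongr)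
  simp only [ha] at h2
  rw [abs_div, Nat.abs_cast, div_le_iff₀ (by positivity)] at h2
  refine h2.trans ?_
  rw [mul_comm]
  gcongr

/-- The rescaled derivatives at grid points. -/
noncomputable def scaled (q : ℝ) (N : ℕ) (f : ℝ → ℝ) (i k : ℕ) : ℝ :=
  D f k (i / N) * (N : ℝ) ^ (q - k)

theorem grid_mem {N i : ℕ} (hN : 1 ≤ N) (hi : i ≤ N) :
    (i / N : ℝ) ∈ Set.Icc (0 : ℝ) 1 := by
  have : (0 : ℝ) < N := by exact_mod_cast hN
  refine ⟨by positivity, ?_⟩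
  rw [div_le_one this]
  exact_mod_cast hi

theorem abs_scaled_succ_sub_le (hq : 0 < q) (hL : 0 ≤ L) {f : ℝ → ℝ} (hf : f ∈ HolderClass L q)
    {N i k : ℕ} (hN : 1 ≤ N) (hi : i < N) (hk : k ≤ holderInt q) :
    |scaled q N f (i + 1) k - ∑ j ∈ Finset.range (holderInt q - k + 1),
        scaled q N f i (k + j) / (j.factorial : ℝ)| ≤ L := by
  have hN0 : (0 : ℝ) < N := by exact_mod_cast hN
  have hd : (((i + 1 : ℕ) : ℝ) / N - (i : ℝ) / N) = (N : ℝ)⁻¹ := by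
    push_cast
    field_simp
    ring
  have ht := taylor hq hL hf hk (grid_mem hN hi.le) (grid_mem hN (Nat.succ_le_of_lt hi))
    (by gcongr; simp)
  rw [hd] at ht
  have hpos : 0 < (N : ℝ) ^ (q - k) := by positivity
  have hmul := mul_le_mul_of_nonneg_right ht hpos.le
  rw [Real.inv_rpow hN0.le, mul_assoc, inv_mul_cancel₀ hpos.ne', mul_one,
    ← abs_of_pos hpos, ← abs_mul, sub_mul, Finset.sum_mul] at hmul
  refine le_trans (le_of_eq ?_) hmul
  congr 2
  refine Finset.sum_congr rfl fun j _ => ?_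
  simp only [scaled]
  rw [show q - ((k + j : ℕ) : ℝ) = (q - k) - (j : ℕ) by push_cast; ring,
    Real.rpow_sub hN0, Real.rpow_natCast, inv_pow]
  field_simp

/-- The prediction, from the rounded data at a grid point, of the data at the next one. -/
noncomputable def predict (l : ℕ) (c : ℕ → ℤ) (k : ℕ) : ℤ :=
  ⌊∑ j ∈ Finset.range (l - k + 1), (c (k + j) : ℝ) / (j.factorial : ℝ)⌋

/-- The rounded data. -/
noncomputable def rounded (q : ℝ) (N : ℕ) (f : ℝ → ℝ) (i k : ℕ) : ℤ := ⌊scaled q N f i k⌋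

theorem predict_congr {l : ℕ} {c c' : ℕ → ℤ} (h : ∀ k ≤ l, c k = c' k) {k : ℕ} (hk : k ≤ l) :
    predict l c k = predict l c' k := by
  unfold predict
  congr 1
  refine Finset.sum_congr rfl fun j hj => ?_
  rw [h (k + j) (by have := Finset.mem_range.1 hj; omega)]

theorem abs_rounded_sub_predict_le (hq : 0 < q) (hL : 0 ≤ L) {f : ℝ → ℝ}
    (hf : f ∈ HolderClass L q) {N i k : ℕ} (hN : 1 ≤ N) (hi : i < N) (hk : k ≤ holderInt q) :
    |((rounded q N f (i + 1) k - predict (holderInt q) (rounded q N f i) k : ℤ) : ℝ)| ≤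
      L + holderInt q + 3 := by
  have h1 := abs_scaled_succ_sub_le hq hL hf hN hi hk
  have h2 : |∑ j ∈ Finset.range (holderInt q - k + 1),
        scaled q N f i (k + j) / (j.factorial : ℝ) -
      ∑ j ∈ Finset.range (holderInt q - k + 1),
        (rounded q N f i (k + j) : ℝ) / (j.factorial : ℝ)| ≤ holderInt q + 1 := by
    rw [← Finset.sum_sub_distrib]
    calc _ ≤ ∑ j ∈ Finset.range (holderInt q - k + 1), |scaled q N f i (k + j) /
            (j.factorial : ℝ) - (rounded q N f i (k + j) : ℝ) / (j.factorial : ℝ)| :=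
          Finset.abs_sum_le_sum_abs _ _
      _ ≤ ∑ j ∈ Finset.range (holderInt q - k + 1), (1 : ℝ) := by
          refine Finset.sum_le_sum fun j _ => ?_
          rw [← sub_div, abs_div, Nat.abs_cast, div_le_one (by positivity)]
          have hfl := Int.floor_le (scaled q N f i (k + j))
          have hlt := Int.lt_floor_add_one (scaled q N f i (k + j))
          have hfac : (1 : ℝ) ≤ j.factorial := Nat.one_le_cast.2 j.factorial_pos
          refine le_trans ?_ hfac
          rw [rounded, abs_le]
          constructor <;> linarith
      _ ≤ holderInt q + 1 := by
          simp only [Finset.sum_const, Finset.card_range, nsmul_eq_mul, mul_one]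
          have : holderInt q - k + 1 ≤ holderInt q + 1 := by omega
          exact_mod_cast this
  have a1 := Int.floor_le (scaled q N f (i + 1) k)
  have a2 := Int.lt_floor_add_one (scaled q N f (i + 1) k)
  have b1 := Int.floor_le (∑ j ∈ Finset.range (holderInt q - k + 1),
    (rounded q N f i (k + j) : ℝ) / (j.factorial : ℝ))
  have b2 := Int.lt_floor_add_one (∑ j ∈ Finset.range (holderInt q - k + 1),
    (rounded q N f i (k + j) : ℝ) / (j.factorial : ℝ))
  rw [abs_le] at h1 h2 ⊢
  push_cast
  rw [show rounded q N f (i + 1) k = ⌊scaled q N f (i + 1) k⌋ from rfl, predict]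
  constructor <;> linarith [h1.1, h1.2, h2.1, h2.2]

/-- Functions with the same rounded data on the grid are uniformly close. -/
theorem abs_sub_le_of_rounded_eq (hq : 0 < q) (hL : 0 ≤ L) {f g : ℝ → ℝ}
    (hf : f ∈ HolderClass L q) (hg : g ∈ HolderClass L q) {N : ℕ} (hN : 1 ≤ N)
    (h : ∀ i ≤ N, ∀ k ≤ holderInt q, rounded q N f i k = rounded q N g i k)
    {y : ℝ} (hy : y ∈ Set.Icc (0 : ℝ) 1) :
    |f y - g y| ≤ (holderInt q + 1 + 2 * L) * (N : ℝ) ^ (-q) := by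
  have hN0 : (0 : ℝ) < N := by exact_mod_cast hN
  set i := ⌊y * N⌋₊ with hi
  have hyN : 0 ≤ y * N := mul_nonneg hy.1 hN0.le
  have hi1 : (i : ℝ) ≤ y * N := Nat.floor_le hyN
  have hi2 : y * N < i + 1 := Nat.lt_floor_add_one _
  have hiN : i ≤ N := by
    have : (i : ℝ) ≤ N := hi1.trans (mul_le_of_le_one_left hN0.le hy.2)
    exact_mod_cast this
  have hx := grid_mem hN hiN
  have hxy : (i : ℝ) / N ≤ y := by rwa [div_le_iff₀ hN0]
  have hd0 : 0 ≤ y - (i : ℝ) / N := sub_nonneg.2 hxy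
  have hd1 : y - (i : ℝ) / N ≤ (N : ℝ)⁻¹ := by
    rw [← one_div, sub_le_iff_le_add, ← add_div, le_div_iff₀ hN0]
    linarith
  have tf := taylor hq hL hf (Nat.zero_le _) hx hy hxy
  have tg := taylor hq hL hg (Nat.zero_le _) hx hy hxy
  have hrem : L * (y - (i : ℝ) / N) ^ (q - (0 : ℕ)) ≤ L * (N : ℝ) ^ (-q) := by
    rw [Real.rpow_neg hN0.le, ← Real.inv_rpow hN0.le, Nat.cast_zero, sub_zero]
    gcongr
  have hmain : |∑ j ∈ Finset.range (holderInt q - 0 + 1),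
        D f (0 + j) (i / N) * (y - i / N) ^ j / (j.factorial : ℝ) -
      ∑ j ∈ Finset.range (holderInt q - 0 + 1),
        D g (0 + j) (i / N) * (y - i / N) ^ j / (j.factorial : ℝ)| ≤
      (holderInt q + 1) * (N : ℝ) ^ (-q) := by
    rw [← Finset.sum_sub_distrib]
    calc _ ≤ ∑ j ∈ Finset.range (holderInt q - 0 + 1),
          |D f (0 + j) (i / N) * (y - i / N) ^ j / (j.factorial : ℝ) -
            D g (0 + j) (i / N) * (y - i / N) ^ j / (j.factorial : ℝ)| :=
          Finset.abs_sum_le_sum_abs _ _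
      _ ≤ ∑ j ∈ Finset.range (holderInt q - 0 + 1), (N : ℝ) ^ (-q) := by
          refine Finset.sum_le_sum fun j hj => ?_
          have hj' : j ≤ holderInt q := by have := Finset.mem_range.1 hj; omega
          have hr := h i hiN j hj'
          have hfl := Int.abs_sub_lt_one_of_floor_eq_floor hr
          rw [scaled, scaled, ← sub_mul, abs_mul, abs_of_pos (a := (N : ℝ) ^ (q - (j : ℝ)))
            (by positivity)] at hfl
          have hfac : (1 : ℝ) ≤ j.factorial := Nat.one_le_cast.2 j.factorial_pos
          rw [← sub_div, ← sub_mul, zero_add, abs_div, Nat.abs_cast, abs_mul,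
            abs_of_nonneg (pow_nonneg hd0 j)]
          calc _ ≤ |D f j (i / N) - D g j (i / N)| * (y - i / N) ^ j / 1 := by gcongr
            _ ≤ |D f j (i / N) - D g j (i / N)| * ((N : ℝ)⁻¹) ^ j := by
                rw [div_one]; gcongr
            _ = (|D f j (i / N) - D g j (i / N)| * (N : ℝ) ^ (q - (j : ℝ))) *
                  (N : ℝ) ^ (-q) := by
                rw [mul_assoc, ← Real.rpow_add hN0, show q - (j : ℝ) + -q = -(j : ℝ) by ring,
                  Real.rpow_neg hN0.le, Real.rpow_natCast, inv_pow]
            _ ≤ 1 * (N : ℝ) ^ (-q) := by gcongr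
            _ = _ := one_mul _
      _ = _ := by simp
  have hf0 : D f 0 y = f y := by simp [D]
  have hg0 : D g 0 y = g y := by simp [D]
  rw [hf0] at tf
  rw [hg0] at tg
  rw [abs_le] at tf tg hmain ⊢
  constructor <;> nlinarith [tf.1, tf.2, tg.1, tg.2, hmain.1, hmain.2]

/-- The finite code of a function: rounded data at `0` and prediction errors along the grid. -/
noncomputable def code (q : ℝ) (N : ℕ) (f : ℝ → ℝ) :
    (Fin (holderInt q + 1) → ℤ) × (Fin N → Fin (holderInt q + 1) → ℤ) :=
  (fun k => rounded q N f 0 k,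
    fun i k => rounded q N f (i + 1) k - predict (holderInt q) (rounded q N f i) k)

theorem rounded_eq_of_code_eq {f g : ℝ → ℝ} {N : ℕ} (h : code q N f = code q N g) (i : ℕ) :
    i ≤ N → ∀ k ≤ holderInt q, rounded q N f i k = rounded q N g i k := by
  induction i with
  | zero =>
    intro _ k hk
    exact congrFun (congrArg Prod.fst h) ⟨k, by omega⟩
  | succ i ih =>
    intro hi k hk
    have h2 := congrFun (congrFun (congrArg Prod.snd h) ⟨i, by omega⟩) ⟨k, by omega⟩
    simp only [code] at h2
    rw [predict_congr (ih (by omega)) hk] at h2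
    exact sub_left_injective h2

end HolderClass

/-- A set whose points are encoded by finitely many codes has a finite subset realizing all
the codes that occur. -/
theorem exists_finset_code_representatives {α β : Type*} (A : Set α) (code : α → β)
    (T : Finset β) (hT : ∀ a ∈ A, code a ∈ T) :
    ∃ S : Finset α, (S : Set α) ⊆ A ∧ S.card ≤ T.card ∧ ∀ a ∈ A, ∃ s ∈ S, code s = code a := by
  classical
  have hfin : (code '' A).Finite := T.finite_toSet.subset (by rintro _ ⟨a, ha, rfl⟩; exact hT a ha)
  obtain ⟨S, hSA, hbij⟩ := (Set.surjOn_image code A).exists_bijOn_subset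
  have hSfin : S.Finite := hbij.finite_iff_finite.2 hfin
  refine ⟨hSfin.toFinset, by simpa using hSA, ?_, ?_⟩
  · refine Finset.card_le_card_of_injOn code (fun a ha => hT a (hSA (by simpa using ha))) ?_
    simpa using hbij.injOn
  · intro a ha
    obtain ⟨s, hs, h⟩ := hbij.surjOn ⟨a, ha, rfl⟩
    exact ⟨s, by simpa using hs, h⟩

/-- Continuous densities on `[0,1]`. -/
def ContDensity : Set (ℝ → ℝ) :=
  {g | Continuous g ∧ (∀ x, 0 ≤ g x) ∧ ∫ x in Set.Icc (0 : ℝ) 1, g x = 1}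

/-- Metric entropy of the Hölder class in the uniform norm. -/
theorem HolderClass.exists_cover {L q : ℝ} (hq : 0 < q) (hL : 0 ≤ L) :
    ∃ C : ℝ, 0 < C ∧ ∀ N : ℕ, 1 ≤ N → ∃ S : Finset (ℝ → ℝ),
      (∀ g ∈ S, g ∈ ContDensity) ∧ (S.card : ℝ) ≤ Real.exp (C * N) ∧
      ∀ f ∈ HolderClass L q, ∃ g ∈ S, ∀ x ∈ Set.Icc (0 : ℝ) 1,
        |f x - g x| ≤ C * (N : ℝ) ^ (-q) := by
  classical
  obtain ⟨B, hB, hD0⟩ := exists_D_zero_bound hq hL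
  set l := holderInt q with hl
  set K : ℕ := ⌈L + l + 3⌉₊ with hK
  set C₁ : ℝ := (l + 1) * (2 * B + 5 + q) + (l + 1) * (2 * K + 1) with hC₁
  set C₂ : ℝ := l + 1 + 2 * L with hC₂
  have hC₂' : 0 < C₂ := by positivity
  refine ⟨C₁ + C₂, by positivity, fun N hN => ?_⟩
  have hN0 : (0 : ℝ) < N := by exact_mod_cast hN
  have hN1 : (1 : ℝ) ≤ N := by exact_mod_cast hN
  set b : ℕ := ⌈B * (N : ℝ) ^ q⌉₊ + 1 with hb
  let T : Finset ((Fin (l + 1) → ℤ) × (Fin N → Fin (l + 1) → ℤ)) :=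
    (Fintype.piFinset fun _ => Finset.Icc (-(b : ℤ)) b) ×ˢ
      (Fintype.piFinset fun _ => Fintype.piFinset fun _ => Finset.Icc (-(K : ℤ)) K)
  have hmemT : ∀ f ∈ HolderClass L q, code q N f ∈ T := by
    intro f hf
    simp only [T, Finset.mem_product, Fintype.mem_piFinset]
    refine ⟨fun k => ?_, fun i k => ?_⟩
    · have hk : (k : ℕ) ≤ l := Nat.lt_succ_iff.1 k.2
      have h1 : |scaled q N f 0 k| ≤ B * (N : ℝ) ^ q := by
        rw [scaled, abs_mul, Nat.cast_zero, zero_div,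
          abs_of_pos (a := (N : ℝ) ^ (q - ((k : ℕ) : ℝ))) (by positivity)]
        have := hD0 f hf k hk
        gcongr
        simp
      have h2 := (h1.trans (Nat.le_ceil _))
      have h3 := Int.floor_le (scaled q N f 0 k)
      have h4 := Int.lt_floor_add_one (scaled q N f 0 k)
      rw [abs_le] at h2
      have h5 : -(b : ℝ) ≤ (⌊scaled q N f 0 k⌋ : ℝ) ∧ (⌊scaled q N f 0 k⌋ : ℝ) ≤ b := by
        rw [hb]; push_cast
        constructor <;> linarith [h2.1, h2.2]
      rw [Finset.mem_Icc]
      exact_mod_cast h5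
    · have h1 := (abs_rounded_sub_predict_le hq hL hf hN i.2 (Nat.lt_succ_iff.1 k.2)).trans
        (Nat.le_ceil _)
      rw [abs_le] at h1
      rw [Finset.mem_Icc]
      exact_mod_cast h1
  have hcardT : (T.card : ℝ) ≤ Real.exp (C₁ * N) := by
    have hcard : (T.card : ℝ) = (2 * b + 1 : ℝ) ^ (l + 1) * (2 * K + 1 : ℝ) ^ ((l + 1) * N) := by
      simp only [T, Finset.card_product, Fintype.card_piFinset, Int.card_Icc, Finset.prod_const,
        Finset.card_univ, Fintype.card_fin]
      rw [show ((b : ℤ) + 1 - -(b : ℤ)).toNat = 2 * b + 1 by omega,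
        show ((K : ℤ) + 1 - -(K : ℤ)).toNat = 2 * K + 1 by omega]
      push_cast
      rw [pow_mul]
    have hb1 : (2 * b + 1 : ℝ) ≤ Real.exp ((2 * B + 5 + q) * N) := by
      have h1 : (b : ℝ) ≤ B * (N : ℝ) ^ q + 2 := by
        rw [hb]; push_cast
        have := Nat.ceil_lt_add_one (a := B * (N : ℝ) ^ q) (by positivity)
        linarith
      have hNq : 1 ≤ (N : ℝ) ^ q := Real.one_le_rpow hN1 hq.le
      have hNe : (N : ℝ) ^ q ≤ Real.exp (q * N) := by
        rw [Real.rpow_def_of_pos hN0, Real.exp_le_exp, mul_comm]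
        gcongr
        exact (Real.log_le_sub_one_of_pos hN0).trans (by linarith)
      have h2 : 2 * B + 5 ≤ Real.exp ((2 * B + 5) * N) := by
        have := Real.add_one_le_exp ((2 * B + 5) * N)
        nlinarith
      calc (2 * b + 1 : ℝ) ≤ (2 * B + 5) * (N : ℝ) ^ q := by nlinarith
        _ ≤ Real.exp ((2 * B + 5) * N) * Real.exp (q * N) := by gcongr
        _ = _ := by rw [← Real.exp_add]; ring_nf
    have hK1 : (2 * K + 1 : ℝ) ≤ Real.exp (2 * K + 1) := by
      linarith [Real.add_one_le_exp (2 * K + 1 : ℝ)]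
    rw [hcard]
    calc _ ≤ Real.exp ((2 * B + 5 + q) * N) ^ (l + 1) * Real.exp (2 * K + 1) ^ ((l + 1) * N) := by
          gcongr
      _ = Real.exp (C₁ * N) := by
          rw [← Real.exp_nat_mul, ← Real.exp_nat_mul, ← Real.exp_add, hC₁]
          push_cast
          ring_nf
  obtain ⟨S, hSA, hScard, hS⟩ := exists_finset_code_representatives _ _ T hmemT
  let ext : (ℝ → ℝ) → ℝ → ℝ := fun f x => f (Set.projIcc (0 : ℝ) 1 zero_le_one x)
  have hext : ∀ f : ℝ → ℝ, ∀ x ∈ Set.Icc (0 : ℝ) 1, ext f x = f x := by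
    intro f x hx
    simp only [ext, Set.projIcc_of_mem zero_le_one hx]
  refine ⟨S.image ext, ?_, ?_, ?_⟩
  · intro g hg
    obtain ⟨f, hf, rfl⟩ := Finset.mem_image.1 hg
    have hfA := hSA hf
    refine ⟨(continuousOn hfA).comp_continuous
      (continuous_subtype_val.comp continuous_projIcc) fun x => Subtype.property _,
      fun x => hfA.1 _ (Subtype.property _), ?_⟩
    rw [setIntegral_congr_fun measurableSet_Icc (hext f)]
    exact hfA.2.1
  · calc ((S.image ext).card : ℝ) ≤ T.card := by exact_mod_cast Finset.card_image_le.trans hScard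
      _ ≤ Real.exp (C₁ * N) := hcardT
      _ ≤ _ := by
        rw [Real.exp_le_exp]
        gcongr
        linarith
  · intro f hf
    obtain ⟨g, hg, hc⟩ := hS f hf
    refine ⟨ext g, Finset.mem_image_of_mem _ hg, fun x hx => ?_⟩
    rw [hext g x hx]
    refine (abs_sub_le_of_rounded_eq hq hL hf (hSA hg) hN
      (fun i hi k hk => rounded_eq_of_code_eq hc.symm i hi k hk) hx).trans ?_
    have : 0 ≤ C₁ := by positivity
    exact mul_le_mul_of_nonneg_right (le_add_of_nonneg_left this) (by positivity)

/-- Covering numbers of the probability simplex in the `ℓ¹` norm. -/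
theorem exists_simplex_cover {m : ℕ} (hm : 1 ≤ m) {δ : ℝ} (hδ : 0 < δ) (hδ1 : δ ≤ 1) :
    ∃ W : Finset (Fin m → ℝ), (∀ w ∈ W, (∀ k, 0 ≤ w k) ∧ ∑ k, w k = 1) ∧
      (W.card : ℝ) ≤ (2 * Real.exp 1 / δ) ^ m ∧
      ∀ π : Fin m → ℝ, (∀ k, 0 ≤ π k) → ∑ k, π k = 1 → ∃ w ∈ W, ∑ k, |π k - w k| ≤ δ := by
  classical
  have hm0 : (0 : ℝ) < m := by exact_mod_cast hm
  set S : ℕ := ⌊m / δ⌋₊ with hS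
  have hSle : (S : ℝ) ≤ m / δ := Nat.floor_le (by positivity)
  let A : Set (Fin m → ℝ) := {w | (∀ k, 0 ≤ w k) ∧ ∑ k, w k = 1}
  let code : (Fin m → ℝ) → Fin m → ℕ := fun w k => ⌊w k * (m / δ)⌋₊
  let T : Finset (Fin m → ℕ) :=
    (Fintype.piFinset fun _ => Finset.range (S + 1)).filter fun b => ∑ k, b k ≤ S
  have hmemT : ∀ w ∈ A, code w ∈ T := by
    rintro w ⟨hw0, hw1⟩
    have hsum : ∑ k, code w k ≤ S := by
      refine Nat.le_floor ?_
      push_cast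
      calc ∑ k, (code w k : ℝ) ≤ ∑ k, w k * (m / δ) :=
            Finset.sum_le_sum fun k _ => Nat.floor_le (mul_nonneg (hw0 k) (by positivity))
        _ = m / δ := by rw [← Finset.sum_mul, hw1, one_mul]
    simp only [T, Finset.mem_filter, Fintype.mem_piFinset, Finset.mem_range]
    refine ⟨fun k => ?_, hsum⟩
    have : code w k ≤ ∑ k, code w k :=
      Finset.single_le_sum (f := fun k => code w k) (fun _ _ => Nat.zero_le _) (Finset.mem_univ k)
    omega
  have hcardT : (T.card : ℝ) ≤ (2 * Real.exp 1 / δ) ^ m := by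
    have hr1 : Real.exp (-δ) < 1 := by simpa using hδ
    have hgeom : ∑ b ∈ Finset.range (S + 1), Real.exp (-δ * b) ≤ 2 / δ := by
      have hsum : ∑ b ∈ Finset.range (S + 1), Real.exp (-δ * b) ≤ (1 - Real.exp (-δ))⁻¹ := by
        rw [← tsum_geometric_of_lt_one (Real.exp_pos _).le hr1]
        have := (summable_geometric_of_lt_one (Real.exp_pos _).le hr1).sum_le_tsum
          (Finset.range (S + 1)) (fun b _ => pow_nonneg (Real.exp_pos _).le b)
        refine le_trans (le_of_eq ?_) this
        refine Finset.sum_congr rfl fun b _ => ?_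
        rw [← Real.exp_nat_mul, mul_comm]
      refine hsum.trans ?_
      rw [inv_le_comm₀ (by linarith) (by positivity), inv_div]
      have h1 : Real.exp (-δ) ≤ (1 + δ)⁻¹ := by
        rw [Real.exp_neg]
        gcongr
        linarith [Real.add_one_le_exp δ]
      have h2 : (1 + δ)⁻¹ ≤ 1 - δ / 2 := by
        rw [inv_le_iff_one_le_mul₀ (by positivity)]
        nlinarith
      linarith
    calc (T.card : ℝ) = ∑ b ∈ T, (1 : ℝ) := by simp
      _ ≤ ∑ b ∈ T, Real.exp m * ∏ k, Real.exp (-δ * b k) := by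
          refine Finset.sum_le_sum fun b hb => ?_
          have hbS : (∑ k, (b k : ℝ)) ≤ m / δ := by
            have : ∑ k, b k ≤ S := (Finset.mem_filter.1 hb).2
            exact le_trans (by exact_mod_cast this) hSle
          rw [← Real.exp_sum, ← Real.exp_add, ← Finset.mul_sum]
          refine Real.one_le_exp ?_
          rw [le_div_iff₀ hδ] at hbS
          linarith
      _ ≤ ∑ b ∈ Fintype.piFinset fun _ : Fin m => Finset.range (S + 1),
            Real.exp m * ∏ k, Real.exp (-δ * b k) :=
          Finset.sum_le_sum_of_subset_of_nonneg (Finset.filter_subset _ _)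
            fun b _ _ => by positivity
      _ = Real.exp m * (∑ b ∈ Finset.range (S + 1), Real.exp (-δ * b)) ^ m := by
          rw [← Finset.mul_sum, Finset.sum_prod_piFinset (Finset.range (S + 1))
            (fun (_ : Fin m) (b : ℕ) => Real.exp (-δ * b))]
          simp
      _ ≤ Real.exp m * (2 / δ) ^ m := by
          gcongr
      _ = _ := by
          rw [show (m : ℝ) = m * 1 by ring, Real.exp_nat_mul, ← mul_pow]
          ring
  obtain ⟨W, hWA, hWcard, hW⟩ := exists_finset_code_representatives A code T hmemT
  refine ⟨W, fun w hw => hWA hw, le_trans (by exact_mod_cast hWcard) hcardT, ?_⟩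
  intro π h0 h1
  obtain ⟨w, hw, hc⟩ := hW π ⟨h0, h1⟩
  refine ⟨w, hw, ?_⟩
  calc ∑ k, |π k - w k| ≤ ∑ k : Fin m, δ / m := by
        refine Finset.sum_le_sum fun k _ => ?_
        have hk : ⌊w k * (m / δ)⌋₊ = ⌊π k * (m / δ)⌋₊ := congrFun hc k
        have hmd : 0 < (m : ℝ) / δ := by positivity
        have a1 := Nat.floor_le (mul_nonneg (h0 k) hmd.le)
        have a2 := Nat.lt_floor_add_one (π k * (m / δ))
        have b1 := Nat.floor_le (mul_nonneg ((hWA hw).1 k) hmd.le)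
        have b2 := Nat.lt_floor_add_one (w k * (m / δ))
        rw [hk] at b1 b2
        have : |π k - w k| * (m / δ) ≤ 1 := by
          rw [← abs_of_pos hmd, ← abs_mul, sub_mul, abs_le]
          constructor <;> linarith
        rwa [← le_div_iff₀ hmd, one_div_div] at this
    _ = δ := by
        simp
        field_simp

/-- Telescoping bound for the difference of two products. -/
theorem abs_prod_sub_prod_le {d : ℕ} (a b : Fin d → ℝ) :
    |∏ j, a j - ∏ j, b j| ≤
      ∑ i, ∏ j, if j < i then |b j| else if j = i then |a j - b j| else |a j| := by
  induction d with
  | zero => simp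
  | succ d ih =>
    rw [Fin.prod_univ_succ, Fin.prod_univ_succ, Fin.sum_univ_succ]
    simp only [Fin.prod_univ_succ]
    have h := ih (fun j => a j.succ) (fun j => b j.succ)
    calc _ = |(a 0 - b 0) * ∏ j : Fin d, a j.succ +
            b 0 * (∏ j : Fin d, a j.succ - ∏ j : Fin d, b j.succ)| := by congr 1; ring
      _ ≤ |a 0 - b 0| * ∏ j : Fin d, |a j.succ| +
            |b 0| * |∏ j : Fin d, a j.succ - ∏ j : Fin d, b j.succ| := by
          refine (abs_add_le _ _).trans (le_of_eq ?_)
          rw [abs_mul, abs_mul, Finset.abs_prod]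
      _ ≤ |a 0 - b 0| * ∏ j : Fin d, |a j.succ| + |b 0| * ∑ i : Fin d, ∏ j : Fin d,
            if j < i then |b j.succ| else if j = i then |a j.succ - b j.succ| else |a j.succ| := by
          gcongr
      _ ≤ _ := by
          rw [Finset.mul_sum]
          simp

section Cube

/-- Lebesgue measure on `[0,1]`. -/
noncomputable def volI : Measure ℝ := volume.restrict (Set.Icc 0 1)

instance : IsProbabilityMeasure volI := ⟨by simp [volI]⟩

/-- Lebesgue measure on the unit cube. -/
noncomputable def volCube (d : ℕ) : Measure (Fin d → ℝ) := Measure.pi fun _ => volI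

instance (d : ℕ) : IsProbabilityMeasure (volCube d) := by unfold volCube; infer_instance

theorem restrict_unitCube (d : ℕ) : volume.restrict (unitCube d) = volCube d := by
  rw [unitCube, volCube, volume_pi, Measure.restrict_pi_pi]
  rfl

theorem measurableSet_unitCube (d : ℕ) : MeasurableSet (unitCube d) :=
  MeasurableSet.univ_pi fun _ => measurableSet_Icc

theorem ae_volCube_mem (d : ℕ) : ∀ᵐ x ∂volCube d, x ∈ unitCube d := by
  rw [← restrict_unitCube]
  exact ae_restrict_mem (measurableSet_unitCube d)

/-- `L¹` distance between product functions. -/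
theorem integral_abs_prod_sub_prod_le {d : ℕ} {u v : Fin d → ℝ → ℝ}
    (hu : ∀ j, Integrable (u j) volI) (hv : ∀ j, Integrable (v j) volI)
    (hu1 : ∀ j, ∫ x, |u j x| ∂volI = 1) (hv1 : ∀ j, ∫ x, |v j x| ∂volI = 1) :
    ∫ x, |∏ j, u j (x j) - ∏ j, v j (x j)| ∂volCube d ≤ ∑ j, ∫ x, |u j x - v j x| ∂volI := by
  let h : Fin d → Fin d → ℝ → ℝ := fun i j x =>
    if j < i then |v j x| else if j = i then |u j x - v j x| else |u j x|
  have hg_int : ∀ i j, Integrable (h i j) volI := by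
    intro i j
    simp only [h]
    split_ifs
    · exact (hv j).abs
    · exact ((hu j).sub (hv j)).abs
    · exact (hu j).abs
  have hprodint : ∀ i, Integrable (fun x : Fin d → ℝ => ∏ j, h i j (x j)) (volCube d) :=
    fun i => Integrable.fintype_prod fun j => hg_int i j
  calc _ ≤ ∫ x, ∑ i, ∏ j, h i j (x j) ∂volCube d := by
        refine integral_mono ?_ (integrable_finsetSum _ fun i _ => hprodint i) fun x =>
          abs_prod_sub_prod_le (fun j => u j (x j)) (fun j => v j (x j))
        exact ((Integrable.fintype_prod hu).sub (Integrable.fintype_prod hv)).abs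
    _ = ∑ i, ∏ j, ∫ x, h i j x ∂volI := by
        rw [integral_finsetSum _ fun i _ => hprodint i]
        refine Finset.sum_congr rfl fun i _ => ?_
        rw [volCube, integral_fintype_prod_eq_prod]
    _ = _ := by
        refine Finset.sum_congr rfl fun i _ => ?_
        rw [Finset.prod_eq_single i]
        · simp [h]
        · intro j _ hji
          simp only [h]
          split_ifs
          · exact hv1 j
          · exact hu1 j
        · simp

end Cube

theorem tvDist_eq {d : ℕ} (p q : (Fin d → ℝ) → ℝ) :
    tvDist p q = (1 / 2) * ∫ x, |p x - q x| ∂volCube d := by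
  rw [tvDist, restrict_unitCube]

section Mixture

variable {m d : ℕ} {u v : Fin m → Fin d → ℝ → ℝ} {π w : Fin m → ℝ}

/-- A mixture of product functions. -/
noncomputable def mix (π : Fin m → ℝ) (u : Fin m → Fin d → ℝ → ℝ) (x : Fin d → ℝ) : ℝ :=
  ∑ k, π k * ∏ j, u k j (x j)

/-- Densities with respect to Lebesgue measure on `[0,1]`. -/
structure IsDensityI (g : ℝ → ℝ) : Prop where
  integrable : Integrable g volI
  nonneg : ∀ x ∈ Set.Icc (0 : ℝ) 1, 0 ≤ g x
  integral_eq : ∫ x, g x ∂volI = 1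

theorem HolderClass.isDensityI {L q : ℝ} {f : ℝ → ℝ} (hf : f ∈ HolderClass L q) :
    IsDensityI f := ⟨integrableOn hf, hf.1, hf.2.1⟩

theorem ContDensity.isDensityI {f : ℝ → ℝ} (hf : f ∈ ContDensity) : IsDensityI f :=
  ⟨hf.1.continuousOn.integrableOn_compact isCompact_Icc, fun x _ => hf.2.1 x, hf.2.2⟩

theorem IsDensityI.integral_abs {g : ℝ → ℝ} (hg : IsDensityI g) : ∫ x, |g x| ∂volI = 1 := by
  rw [← hg.integral_eq]
  exact setIntegral_congr_fun measurableSet_Icc fun x hx => abs_of_nonneg (hg.nonneg x hx)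

theorem integrable_mix (hu : ∀ k j, IsDensityI (u k j)) : Integrable (mix π u) (volCube d) :=
  integrable_finsetSum _ fun k _ =>
    (Integrable.fintype_prod fun j => (hu k j).integrable).const_mul (π k)

theorem integral_mix (hu : ∀ k j, IsDensityI (u k j)) (hπ : ∑ k, π k = 1) :
    ∫ x, mix π u x ∂volCube d = 1 := by
  have hU : ∀ k, Integrable (fun x : Fin d → ℝ => π k * ∏ j, u k j (x j)) (volCube d) :=
    fun k => (Integrable.fintype_prod fun j => (hu k j).integrable).const_mul (π k)
  unfold mix
  rw [integral_finsetSum _ fun k _ => hU k, ← hπ]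
  refine Finset.sum_congr rfl fun k _ => ?_
  rw [integral_const_mul, volCube, integral_fintype_prod_eq_prod]
  simp [(hu k _).integral_eq]

theorem mix_nonneg (hu : ∀ k j, IsDensityI (u k j)) (hπ : ∀ k, 0 ≤ π k) {x : Fin d → ℝ}
    (hx : x ∈ unitCube d) : 0 ≤ mix π u x :=
  Finset.sum_nonneg fun k _ => mul_nonneg (hπ k) <|
    Finset.prod_nonneg fun j _ => (hu k j).nonneg _ (hx j (Set.mem_univ j))

theorem integral_abs_mix_sub_mix_le (hu : ∀ k j, IsDensityI (u k j))
    (hv : ∀ k j, IsDensityI (v k j)) (hw : ∀ k, 0 ≤ w k) (hw1 : ∑ k, w k = 1) {δ ε : ℝ}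
    (hδ : ∑ k, |π k - w k| ≤ δ) (hε : ∀ k j, ∫ x, |u k j x - v k j x| ∂volI ≤ ε) :
    ∫ x, |mix π u x - mix w v x| ∂volCube d ≤ δ + d * ε := by
  have hU : ∀ k, Integrable (fun x : Fin d → ℝ => ∏ j, u k j (x j)) (volCube d) := fun k =>
    Integrable.fintype_prod fun j => (hu k j).integrable
  have hV : ∀ k, Integrable (fun x : Fin d → ℝ => ∏ j, v k j (x j)) (volCube d) := fun k =>
    Integrable.fintype_prod fun j => (hv k j).integrable
  have hA : ∀ k, Integrable (fun x : Fin d → ℝ => |π k - w k| * |∏ j, u k j (x j)|)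
      (volCube d) := fun k => (hU k).abs.const_mul _
  have hB : ∀ k, Integrable (fun x : Fin d → ℝ =>
      w k * |∏ j, u k j (x j) - ∏ j, v k j (x j)|) (volCube d) := fun k =>
    ((hU k).sub (hV k)).abs.const_mul _
  calc _ ≤ ∫ x, ∑ k, (|π k - w k| * |∏ j, u k j (x j)| +
          w k * |∏ j, u k j (x j) - ∏ j, v k j (x j)|) ∂volCube d := by
        refine integral_mono ((integrable_mix hu).sub (integrable_mix hv)).abs
          (integrable_finsetSum _ fun k _ => (hA k).add (hB k)) fun x => ?_
        simp only [mix, ← Finset.sum_sub_distrib]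
        refine (Finset.abs_sum_le_sum_abs _ _).trans (Finset.sum_le_sum fun k _ => ?_)
        calc _ = |(π k - w k) * ∏ j, u k j (x j) +
                w k * (∏ j, u k j (x j) - ∏ j, v k j (x j))| := by congr 1; ring
          _ ≤ _ := (abs_add_le _ _).trans (le_of_eq (by
                rw [abs_mul, abs_mul, abs_of_nonneg (hw k)]))
    _ = ∑ k, (|π k - w k| * 1 +
          w k * ∫ x, |∏ j, u k j (x j) - ∏ j, v k j (x j)| ∂volCube d) := by
        rw [integral_finsetSum]
        swap
        · exact fun k _ => (hA k).add (hB k)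
        refine Finset.sum_congr rfl fun k _ => ?_
        rw [integral_add (hA k) (hB k), integral_const_mul, integral_const_mul]
        congr 2
        simp only [Finset.abs_prod]
        rw [volCube, integral_fintype_prod_eq_prod fun j y => |u k j y|]
        simp [(hu k _).integral_abs]
    _ ≤ ∑ k, (|π k - w k| + w k * (d * ε)) := by
        refine Finset.sum_le_sum fun k _ => ?_
        rw [mul_one]
        gcongr
        · exact hw k
        refine (integral_abs_prod_sub_prod_le (fun j => (hu k j).integrable)
          (fun j => (hv k j).integrable) (fun j => (hu k j).integral_abs)
          (fun j => (hv k j).integral_abs)).trans ?_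
        refine (Finset.sum_le_sum fun j _ => hε k j).trans ?_
        simp
    _ ≤ δ + d * ε := by
        rw [Finset.sum_add_distrib, ← Finset.sum_mul, hw1, one_mul]
        gcongr

theorem measurable_mix (hu : ∀ k j, Measurable (u k j)) : Measurable (mix π u) := by
  unfold mix
  refine Finset.measurable_fun_sum _ fun k _ => Measurable.const_mul ?_ _
  exact Finset.measurable_fun_prod _ fun j _ => (hu k j).comp (measurable_pi_apply j)

end Mixture

/-- A finite net of measurable densities for the mixture class in total variation. -/
theorem exists_mixture_net {L q : ℝ} (hq : 0 < q) (hL : 0 ≤ L) :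
    ∃ C : ℝ, 0 < C ∧ ∀ m d N : ℕ, 1 ≤ m → 1 ≤ d → 1 ≤ N →
      ∃ (ι : Type) (_ : Fintype ι) (p : ι → (Fin d → ℝ) → ℝ),
        (∀ i, Measurable (p i)) ∧ (∀ i, ∀ x ∈ unitCube d, 0 ≤ p i x) ∧
        (∀ i, Integrable (p i) (volCube d)) ∧ (∀ i, ∫ x, p i x ∂volCube d = 1) ∧
        (Fintype.card ι : ℝ) ≤ Real.exp (C * (m * d * N)) ∧
        ∀ f ∈ MixtureClass L q m d, ∃ i,
          ∫ x, |p i x - f x| ∂volCube d ≤ C * (d * (N : ℝ) ^ (-q)) := by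
  obtain ⟨C, hC, hcover⟩ := HolderClass.exists_cover hq hL
  refine ⟨C + (2 + q) + 1, by positivity, fun m d N hm hd hN => ?_⟩
  obtain ⟨S, hS, hScard, hScov⟩ := hcover N hN
  have hN0 : (0 : ℝ) < N := by exact_mod_cast hN
  have hN1 : (1 : ℝ) ≤ N := by exact_mod_cast hN
  have hd1 : (1 : ℝ) ≤ d := by exact_mod_cast hd
  have hm1 : (1 : ℝ) ≤ m := by exact_mod_cast hm
  have hδ : 0 < (N : ℝ) ^ (-q) := by positivity
  have hδ1 : (N : ℝ) ^ (-q) ≤ 1 := Real.rpow_le_one_of_one_le_of_nonpos hN1 (by linarith)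
  obtain ⟨W, hW, hWcard, hWcov⟩ := exists_simplex_cover hm hδ hδ1
  have hdens : ∀ g : S, IsDensityI g.1 := fun g => ContDensity.isDensityI (hS g.1 g.2)
  refine ⟨W × (Fin m → Fin d → S), inferInstance,
    fun i => mix i.1.1 fun k j => (i.2 k j).1, ?_, ?_, ?_, ?_, ?_, ?_⟩
  · exact fun i => measurable_mix fun k j => (hS _ (i.2 k j).2).1.measurable
  · exact fun i x hx => mix_nonneg (fun k j => hdens _) (hW _ i.1.2).1 hx
  · exact fun i => integrable_mix fun k j => hdens _
  · exact fun i => integral_mix (fun k j => hdens _) (hW _ i.1.2).2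
  · have hcard : (Fintype.card (W × (Fin m → Fin d → S)) : ℝ) =
        (W.card : ℝ) * (S.card : ℝ) ^ (d * m) := by
      simp [Fintype.card_prod, pow_mul]
    have hbase : 2 * Real.exp 1 / (N : ℝ) ^ (-q) ≤ Real.exp ((2 + q) * N) := by
      have h2 : (2 : ℝ) ≤ Real.exp 1 := by linarith [Real.add_one_le_exp (1 : ℝ)]
      have hNe : (N : ℝ) ^ q ≤ Real.exp (q * N) := by
        rw [Real.rpow_def_of_pos hN0, Real.exp_le_exp, mul_comm]
        gcongr
        exact (Real.log_le_sub_one_of_pos hN0).trans (by linarith)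
      rw [Real.rpow_neg hN0.le, div_inv_eq_mul]
      calc _ ≤ Real.exp 1 * Real.exp 1 * Real.exp (q * N) := by gcongr
        _ = Real.exp (2 + q * N) := by rw [← Real.exp_add, ← Real.exp_add]; ring_nf
        _ ≤ _ := by
          rw [Real.exp_le_exp]
          nlinarith
    rw [hcard]
    calc _ ≤ Real.exp ((2 + q) * N) ^ m * Real.exp (C * N) ^ (d * m) := by
          gcongr
          exact hWcard.trans (by gcongr)
      _ = Real.exp ((2 + q) * (m * 1 * N) + C * (m * d * N)) := by
          rw [← Real.exp_nat_mul, ← Real.exp_nat_mul, ← Real.exp_add]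
          push_cast
          ring_nf
      _ ≤ _ := by
          rw [Real.exp_le_exp]
          have : (2 + q) * (m * 1 * N) ≤ (2 + q) * (m * d * N) := by gcongr
          have : 0 ≤ (m * d * N : ℝ) := by positivity
          nlinarith
  · rintro f ⟨π, u, hπ0, hπ1, hu, rfl⟩
    obtain ⟨w, hw, hdist⟩ := hWcov π hπ0 hπ1
    choose g hg hgu using fun k j => hScov (u k j) (hu k j)
    refine ⟨(⟨w, hw⟩, fun k j => ⟨g k j, hg k j⟩), ?_⟩
    have hε : ∀ k j, ∫ x, |u k j x - g k j x| ∂volI ≤ C * (N : ℝ) ^ (-q) := by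
      intro k j
      calc _ ≤ ∫ x, C * (N : ℝ) ^ (-q) ∂volI := by
            refine setIntegral_mono_on ?_ (integrable_const (μ := volI) _) measurableSet_Icc
              fun x hx => hgu k j x hx
            exact ((HolderClass.integrableOn (hu k j)).sub (hdens ⟨_, hg k j⟩).integrable).abs
        _ = _ := by simp
    have key := integral_abs_mix_sub_mix_le (fun k j => HolderClass.isDensityI (hu k j))
      (fun k j => hdens ⟨_, hg k j⟩) (hW w hw).1 (hW w hw).2 hdist hε
    simp only [abs_sub_comm (mix w _ _)]
    refine key.trans ?_
    have h1 : (N : ℝ) ^ (-q) ≤ d * (N : ℝ) ^ (-q) := le_mul_of_one_le_left hδ.le hd1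
    nlinarith

section Concentration

variable {X : Type*} [MeasurableSpace X] {n : ℕ}

/-- The centered count of the sample points in `A`. -/
noncomputable def centeredCount (P : Measure X) (A : Set X) (s : Fin n → X) : ℝ :=
  ∑ r, (A.indicator 1 (s r) - P.real A)

theorem exp_centeredCount_eq_prod (P : Measure X) (A : Set X) (t : ℝ) (s : Fin n → X) :
    Real.exp (t * centeredCount P A s) =
      ∏ r, Real.exp (t * (A.indicator 1 (s r) - P.real A)) := by
  rw [centeredCount, Finset.mul_sum, Real.exp_sum]

theorem hasSubgaussianMGF_indicator (P : Measure X) [IsProbabilityMeasure P] {A : Set X}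
    (hA : MeasurableSet A) :
    ProbabilityTheory.HasSubgaussianMGF (fun x => A.indicator (1 : X → ℝ) x - P.real A)
      (1 / 4) P := by
  have h := ProbabilityTheory.hasSubgaussianMGF_of_mem_Icc (μ := P)
    (X := A.indicator (1 : X → ℝ)) (a := 0) (b := 1)
    ((measurable_one.indicator hA).aemeasurable) (Filter.Eventually.of_forall fun x => by
      by_cases hx : x ∈ A <;> simp [hx])
  rw [integral_indicator_one hA] at h
  convert h using 1
  simp
  norm_num

theorem integrable_exp_centeredCount (P : Measure X) [IsProbabilityMeasure P] {A : Set X}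
    (hA : MeasurableSet A) (t : ℝ) :
    Integrable (fun s : Fin n → X => Real.exp (t * centeredCount P A s))
      (Measure.pi fun _ => P) := by
  simp only [exp_centeredCount_eq_prod]
  exact Integrable.fintype_prod fun _ => (hasSubgaussianMGF_indicator P hA).integrable_exp_mul t

theorem integral_exp_centeredCount_le (P : Measure X) [IsProbabilityMeasure P] {A : Set X}
    (hA : MeasurableSet A) (t : ℝ) :
    ∫ s : Fin n → X, Real.exp (t * centeredCount P A s) ∂(Measure.pi fun _ => P) ≤
      Real.exp (n * (t ^ 2 / 8)) := by
  simp only [exp_centeredCount_eq_prod]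
  rw [integral_fintype_prod_eq_prod fun (_ : Fin n) x =>
    Real.exp (t * (A.indicator (1 : X → ℝ) x - P.real A))]
  simp only [Finset.prod_const, Finset.card_univ, Fintype.card_fin]
  rw [Real.exp_nat_mul]
  have h := (hasSubgaussianMGF_indicator P hA).mgf_le t
  rw [ProbabilityTheory.mgf] at h
  gcongr
  refine h.trans (le_of_eq ?_)
  congr 1
  push_cast
  ring

theorem sq_le_add_exp {a V t : ℝ} {n : ℕ} (ha : 0 < a) (hV : 1 ≤ V) (hnV : n * a ^ 2 = V)
    (ht : 0 ≤ t) :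
    t ^ 2 ≤ 4 * a ^ 2 + 4 * a ^ 2 * Real.exp (4 * a * (n * t) - 8 * V) := by
  rcases le_or_gt t (2 * a) with h | h
  · have : 0 ≤ 4 * a ^ 2 * Real.exp (4 * a * (n * t) - 8 * V) := by positivity
    nlinarith
  · obtain ⟨s, hs, rfl⟩ : ∃ s, 0 < s ∧ t = 2 * a + s := ⟨t - 2 * a, by linarith, by ring⟩
    have hx : 4 * a * (n * (2 * a + s)) - 8 * V = 4 * a * n * s := by rw [← hnV]; ring
    rw [hx]
    have hq := Real.quadratic_le_exp_of_nonneg (x := 4 * a * n * s) (by positivity)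
    have h1 : 4 * a ^ 2 * (1 + 4 * a * n * s + (4 * a * n * s) ^ 2 / 2) ≤
        4 * a ^ 2 * Real.exp (4 * a * n * s) := by gcongr
    have h2 : 4 * a ^ 2 * (1 + 4 * a * n * s + (4 * a * n * s) ^ 2 / 2) =
        4 * a ^ 2 + 16 * V * (a * s) + 32 * V ^ 2 * s ^ 2 := by rw [← hnV]; ring
    have h3 : 0 < a * s := mul_pos ha hs
    have h4 : a * s ≤ V * (a * s) := le_mul_of_one_le_left h3.le hV
    have h5 : s ^ 2 ≤ V ^ 2 * s ^ 2 := le_mul_of_one_le_left (sq_nonneg s) (by nlinarith)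
    nlinarith

/-- Maximal inequality for the squared deviations of empirical frequencies over finitely many
sets. -/
theorem exists_dominating_deviation {κ : Type*} [Fintype κ] (P : Measure X)
    [IsProbabilityMeasure P] (hn : 1 ≤ n) {A : κ → Set X} (hA : ∀ k, MeasurableSet (A k))
    {V : ℝ} (hV : 1 ≤ V) (hcard : (Fintype.card κ : ℝ) ≤ Real.exp V) :
    ∃ G : (Fin n → X) → ℝ, Integrable G (Measure.pi fun _ => P) ∧
      ∫ s, G s ∂(Measure.pi fun _ => P) ≤ 12 * V / n ∧
      (∀ s, 0 ≤ G s) ∧ ∀ s k, (centeredCount P (A k) s / n) ^ 2 ≤ G s := by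
  have hn0 : (0 : ℝ) < n := by exact_mod_cast hn
  set a := Real.sqrt (V / n) with ha
  have ha2 : a ^ 2 = V / n := Real.sq_sqrt (by positivity)
  have ha0 : 0 < a := Real.sqrt_pos.2 (by positivity)
  have hnV : n * a ^ 2 = V := by rw [ha2]; field_simp
  let H : κ → (Fin n → X) → ℝ := fun k s =>
    Real.exp ((4 * a) * centeredCount P (A k) s) + Real.exp ((-(4 * a)) * centeredCount P (A k) s)
  have hHint : ∀ k, Integrable (H k) (Measure.pi fun _ => P) := fun k =>
    (integrable_exp_centeredCount P (hA k) _).add (integrable_exp_centeredCount P (hA k) _)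
  have hHle : ∀ k, ∫ s, H k s ∂(Measure.pi fun _ => P) ≤ 2 * Real.exp (2 * V) := by
    intro k
    have e1 := integral_exp_centeredCount_le (n := n) P (hA k) (4 * a)
    have e2 := integral_exp_centeredCount_le (n := n) P (hA k) (-(4 * a))
    have e3 : (n : ℝ) * ((4 * a) ^ 2 / 8) = 2 * V := by rw [← hnV]; ring
    have e4 : (n : ℝ) * ((-(4 * a)) ^ 2 / 8) = 2 * V := by rw [← hnV]; ring
    rw [e3] at e1
    rw [e4] at e2
    have : ∫ s, H k s ∂(Measure.pi fun _ => P) = _ :=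
      integral_add (integrable_exp_centeredCount (n := n) P (hA k) (4 * a))
        (integrable_exp_centeredCount P (hA k) (-(4 * a)))
    rw [this]
    linarith
  have hHnn : ∀ k s, 0 ≤ H k s := fun k s => by positivity
  have hsumint : Integrable (fun s => 4 * a ^ 2 * Real.exp (-(8 * V)) * ∑ k, H k s)
      (Measure.pi fun _ => P) := (integrable_finsetSum _ fun k _ => hHint k).const_mul _
  refine ⟨fun s => 4 * a ^ 2 + 4 * a ^ 2 * Real.exp (-(8 * V)) * ∑ k, H k s,
    (integrable_const _).add hsumint, ?_, ?_, ?_⟩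
  · have hconst : ∫ _ : Fin n → X, 4 * a ^ 2 ∂(Measure.pi fun _ => P) = 4 * a ^ 2 := by simp
    rw [integral_add (integrable_const _) hsumint, hconst, integral_const_mul,
      integral_finsetSum _ fun k _ => hHint k]
    have hs : ∑ k, ∫ s, H k s ∂(Measure.pi fun _ => P) ≤ 2 * Real.exp (3 * V) := by
      calc _ ≤ ∑ _k : κ, 2 * Real.exp (2 * V) := Finset.sum_le_sum fun k _ => hHle k
        _ = Fintype.card κ * (2 * Real.exp (2 * V)) := by simp
        _ ≤ Real.exp V * (2 * Real.exp (2 * V)) := by gcongr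
        _ = 2 * Real.exp (3 * V) := by
            rw [mul_left_comm, ← Real.exp_add]
            ring_nf
    have he : Real.exp (-(8 * V)) * (2 * Real.exp (3 * V)) ≤ 2 := by
      rw [mul_left_comm, ← Real.exp_add]
      have : Real.exp (-(8 * V) + 3 * V) ≤ 1 := Real.exp_le_one_iff.2 (by linarith)
      linarith
    calc _ ≤ 4 * a ^ 2 + 4 * a ^ 2 * (Real.exp (-(8 * V)) * (2 * Real.exp (3 * V))) := by
          rw [mul_assoc (4 * a ^ 2)]
          gcongr
      _ ≤ 4 * a ^ 2 + 4 * a ^ 2 * 2 := by gcongr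
      _ = 12 * V / n := by rw [ha2]; ring
  · intro s
    have : 0 ≤ ∑ k, H k s := Finset.sum_nonneg fun k _ => hHnn k s
    positivity
  · intro s k
    have h1 := sq_le_add_exp ha0 hV hnV (abs_nonneg (centeredCount P (A k) s / n))
    rw [sq_abs] at h1
    refine h1.trans ?_
    beta_reduce
    rw [mul_assoc (4 * a ^ 2)]
    gcongr
    rw [sub_eq_neg_add, Real.exp_add]
    gcongr
    refine le_trans ?_ (Finset.single_le_sum (fun k _ => hHnn k s) (Finset.mem_univ k))
    rw [abs_div, Nat.abs_cast, mul_div_cancel₀ _ hn0.ne']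
    rcases abs_choice (centeredCount P (A k) s) with h | h <;> rw [h]
    · exact le_add_of_nonneg_right (Real.exp_pos _).le
    · rw [mul_neg, ← neg_mul]
      exact le_add_of_nonneg_left (Real.exp_pos _).le

end Concentration

section Yatracos

variable {X : Type*} [MeasurableSpace X] {μ : Measure X}

theorem isProbabilityMeasure_withDensity_ofReal {f : X → ℝ} (hf : Integrable f μ)
    (hf0 : 0 ≤ᵐ[μ] f) (hf1 : ∫ x, f x ∂μ = 1) :
    IsProbabilityMeasure (μ.withDensity fun x => ENNReal.ofReal (f x)) :=
  ⟨by rw [withDensity_apply _ MeasurableSet.univ, Measure.restrict_univ,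
    ← ofReal_integral_eq_lintegral_ofReal hf hf0, hf1, ENNReal.ofReal_one]⟩

theorem real_withDensity_ofReal {f : X → ℝ} (hf : Integrable f μ) (hf0 : 0 ≤ᵐ[μ] f)
    {A : Set X} (hA : MeasurableSet A) :
    (μ.withDensity fun x => ENNReal.ofReal (f x)).real A = ∫ x in A, f x ∂μ := by
  rw [measureReal_def, withDensity_apply _ hA,
    ← ofReal_integral_eq_lintegral_ofReal hf.integrableOn (ae_restrict_of_ae hf0),
    ENNReal.toReal_ofReal (integral_nonneg_of_ae (ae_restrict_of_ae hf0))]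

/-- Scheffé's identity. -/
theorem integral_abs_sub_eq_two_mul {p q : X → ℝ} (hp : Integrable p μ) (hq : Integrable q μ)
    (hpm : Measurable p) (hqm : Measurable q) (h : ∫ x, p x ∂μ = ∫ x, q x ∂μ) :
    ∫ x, |p x - q x| ∂μ =
      2 * (∫ x in {x | q x < p x}, p x ∂μ - ∫ x in {x | q x < p x}, q x ∂μ) := by
  have hA : MeasurableSet {x | q x < p x} := measurableSet_lt hqm hpm
  have hpq : Integrable (fun x => p x - q x) μ := hp.sub hq
  have h0 : ∫ x, (p x - q x) ∂μ = 0 := by rw [integral_sub hp hq, h, sub_self]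
  rw [← integral_sub hp.integrableOn hq.integrableOn]
  have h1 : ∀ x, |p x - q x| =
      2 * ({x | q x < p x}.indicator (fun x => p x - q x) x) - (p x - q x) := by
    intro x
    by_cases hx : q x < p x
    · rw [Set.indicator_of_mem (show x ∈ {x | q x < p x} from hx), abs_of_pos (by linarith)]
      ring
    · rw [Set.indicator_of_notMem (show x ∉ {x | q x < p x} from hx),
        abs_of_nonpos (by linarith)]
      ring
  simp_rw [h1]
  rw [integral_sub ((hpq.indicator hA).const_mul 2) hpq, integral_const_mul,
    integral_indicator hA]
  rw [h0, sub_zero]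

/-- The minimum distance estimator over a finite family of densities. -/
theorem exists_minimum_distance_selector {ι : Type} [Fintype ι] [Nonempty ι] {p : ι → X → ℝ}
    (hpm : ∀ i, Measurable (p i)) (hp : ∀ i, Integrable (p i) μ) (hp1 : ∀ i, ∫ x, p i x ∂μ = 1)
    {n : ℕ} (hn : 1 ≤ n) :
    ∃ idx : (Fin n → X) → ι, (∀ i, MeasurableSet (idx ⁻¹' {i})) ∧
      ∀ f : X → ℝ, Integrable f μ → 0 ≤ᵐ[μ] f → ∫ x, f x ∂μ = 1 →
        ∀ V : ℝ, 1 ≤ V → (Fintype.card ι : ℝ) ^ 2 ≤ Real.exp V → ∀ i₀,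
          ∫⁻ s, ENNReal.ofReal (((1 / 2) * ∫ x, |p (idx s) x - f x| ∂μ) ^ 2)
              ∂(Measure.pi fun _ => μ.withDensity fun x => ENNReal.ofReal (f x)) ≤
            ENNReal.ofReal (13 * (∫ x, |p i₀ x - f x| ∂μ) ^ 2 + 96 * V / n) := by
  classical
  have hn0 : (0 : ℝ) < n := by exact_mod_cast hn
  let A : ι × ι → Set X := fun κ => {x | p κ.2 x < p κ.1 x}
  have hA : ∀ κ, MeasurableSet (A κ) := fun κ => measurableSet_lt (hpm _) (hpm _)
  let data : (Fin n → X) → (ι × ι → Fin n → Bool) := fun s κ r => decide (s r ∈ A κ)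
  have hdata : Measurable data := by
    refine measurable_pi_lambda _ fun κ => measurable_pi_lambda _ fun r => ?_
    refine measurable_to_bool ?_
    have : (fun s : Fin n → X => data s κ r) ⁻¹' {true} = (fun s => s r) ⁻¹' A κ := by
      ext s; simp [data]
    rw [this]
    exact measurable_pi_apply r (hA κ)
  let emp : (ι × ι → Fin n → Bool) → ι × ι → ℝ := fun b κ =>
    (∑ r, if b κ r then (1 : ℝ) else 0) / n
  let score : (ι × ι → Fin n → Bool) → ι → ℝ := fun b i =>
    ⨆ κ, |∫ x in A κ, p i x ∂μ - emp b κ|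
  choose sel hsel using fun b => Finite.exists_min (score b)
  refine ⟨fun s => sel (data s), fun i => ?_, ?_⟩
  · have : (fun s => sel (data s)) ⁻¹' {i} = data ⁻¹' (sel ⁻¹' {i}) := rfl
    rw [this]
    exact hdata (Set.toFinite _).measurableSet
  intro f hf hf0 hf1 V hV hcard i₀
  set P := μ.withDensity fun x => ENNReal.ofReal (f x) with hP
  have : IsProbabilityMeasure P := isProbabilityMeasure_withDensity_ofReal hf hf0 hf1
  obtain ⟨G, hGint, hGle, hG0, hG⟩ := exists_dominating_deviation (n := n) P hn hA hV
    (by rw [Fintype.card_prod]; push_cast; rwa [← sq])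
  set E := ∫ x, |p i₀ x - f x| ∂μ with hE
  have hE0 : 0 ≤ E := integral_nonneg fun x => abs_nonneg _
  have hdev : ∀ s κ, |P.real (A κ) - emp (data s) κ| ≤ Real.sqrt (G s) := by
    intro s κ
    refine Real.abs_le_sqrt (le_trans (le_of_eq ?_) (hG s κ))
    have : centeredCount P (A κ) s / n = emp (data s) κ - P.real (A κ) := by
      simp only [centeredCount, emp, data, Finset.sum_sub_distrib, Finset.sum_const,
        Finset.card_univ, Fintype.card_fin, nsmul_eq_mul, decide_eq_true_eq, Set.indicator_apply,
        Pi.one_apply]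
      field_simp
    rw [this]
    ring
  have hbias : ∀ κ, |∫ x in A κ, p i₀ x ∂μ - P.real (A κ)| ≤ E := by
    intro κ
    rw [hP, real_withDensity_ofReal hf hf0 (hA κ),
      ← integral_sub (hp i₀).integrableOn hf.integrableOn]
    refine (abs_integral_le_integral_abs).trans ?_
    exact setIntegral_le_integral ((hp i₀).sub hf).abs
      (Filter.Eventually.of_forall fun x => abs_nonneg _)
  have hscore : ∀ s, score (data s) i₀ ≤ E + Real.sqrt (G s) := by
    intro s
    refine ciSup_le fun κ => ?_
    exact (abs_sub_le _ (P.real (A κ)) _).trans (add_le_add (hbias κ) (hdev s κ))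
  have hle_score : ∀ b i κ, |∫ x in A κ, p i x ∂μ - emp b κ| ≤ score b i := fun b i κ =>
    le_ciSup (f := fun κ => |∫ x in A κ, p i x ∂μ - emp b κ|) (Set.finite_range _).bddAbove κ
  have hL1 : ∀ s, ∫ x, |p (sel (data s)) x - f x| ∂μ ≤ 5 * E + 4 * Real.sqrt (G s) := by
    intro s
    set b := data s
    have h1 : ∫ x, |p (sel b) x - p i₀ x| ∂μ ≤ 4 * score b i₀ := by
      rw [integral_abs_sub_eq_two_mul (hp _) (hp _) (hpm _) (hpm _) ((hp1 _).trans (hp1 _).symm)]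
      have a1 := hle_score b (sel b) (sel b, i₀)
      have a2 := hle_score b i₀ (sel b, i₀)
      have a3 := hsel b i₀
      simp only [A] at a1 a2
      rw [abs_le] at a1 a2
      linarith [a1.2, a2.1]
    have h2 : ∫ x, |p (sel b) x - f x| ∂μ ≤ ∫ x, (|p (sel b) x - p i₀ x| + |p i₀ x - f x|) ∂μ :=
      integral_mono ((hp _).sub hf).abs (((hp _).sub (hp _)).abs.add ((hp _).sub hf).abs)
        fun x => abs_sub_le _ _ _
    have h3 : ∫ x, (|p (sel b) x - p i₀ x| + |p i₀ x - f x|) ∂μ =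
        ∫ x, |p (sel b) x - p i₀ x| ∂μ + E :=
      integral_add ((hp _).sub (hp _)).abs ((hp _).sub hf).abs
    linarith [hscore s]
  have hsq : ∀ s, ((1 / 2) * ∫ x, |p (sel (data s)) x - f x| ∂μ) ^ 2 ≤ 13 * E ^ 2 + 8 * G s := by
    intro s
    have h0 : 0 ≤ ∫ x, |p (sel (data s)) x - f x| ∂μ := integral_nonneg fun x => abs_nonneg _
    have h1 := hL1 s
    have h2 := Real.sq_sqrt (hG0 s)
    have h3 := Real.sqrt_nonneg (G s)
    have h4 : (∫ x, |p (sel (data s)) x - f x| ∂μ) ^ 2 ≤ (5 * E + 4 * Real.sqrt (G s)) ^ 2 := by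
      gcongr
    nlinarith [sq_nonneg (5 * E - 4 * Real.sqrt (G s)), sq_nonneg E]
  calc _ ≤ ∫⁻ s, ENNReal.ofReal (13 * E ^ 2 + 8 * G s) ∂(Measure.pi fun _ => P) :=
        lintegral_mono fun s => ENNReal.ofReal_le_ofReal (hsq s)
    _ = ENNReal.ofReal (∫ s, (13 * E ^ 2 + 8 * G s) ∂(Measure.pi fun _ => P)) := by
        rw [ofReal_integral_eq_lintegral_ofReal]
        · exact (integrable_const _).add (hGint.const_mul 8)
        · refine Filter.Eventually.of_forall fun s => ?_
          have := hG0 s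
          change 0 ≤ 13 * E ^ 2 + 8 * G s
          positivity
    _ ≤ _ := by
        refine ENNReal.ofReal_le_ofReal ?_
        have hconst : ∫ _ : Fin n → X, 13 * E ^ 2 ∂(Measure.pi fun _ => P) = 13 * E ^ 2 := by
          simp
        rw [integral_add (integrable_const _) (hGint.const_mul 8), hconst, integral_const_mul]
        have : 96 * V / n = 8 * (12 * V / n) := by ring
        rw [this]
        gcongr

end Yatracos

theorem one_mem_holderClass {L q : ℝ} (hL : 0 ≤ L) : (fun _ => (1 : ℝ)) ∈ HolderClass L q := by
  refine ⟨fun _ _ => zero_le_one, by simp, contDiffOn_const, fun x _ y _ => ?_⟩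
  have h : iteratedDerivWithin (holderInt q) (fun _ : ℝ => (1 : ℝ)) (Set.Icc 0 1) x =
      iteratedDerivWithin (holderInt q) (fun _ : ℝ => (1 : ℝ)) (Set.Icc 0 1) y := by
    simp only [iteratedDerivWithin_const]
  rw [h, sub_self, abs_zero]
  positivity

section MixtureClass

variable {L q : ℝ} {m d n : ℕ} {f : (Fin d → ℝ) → ℝ}

theorem MixtureClass.integrable (hf : f ∈ MixtureClass L q m d) : Integrable f (volCube d) := by
  obtain ⟨π, u, hπ, hπ1, hu, rfl⟩ := hf
  exact integrable_mix fun k j => HolderClass.isDensityI (hu k j)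

theorem MixtureClass.nonneg (hf : f ∈ MixtureClass L q m d) {x : Fin d → ℝ}
    (hx : x ∈ unitCube d) : 0 ≤ f x := by
  obtain ⟨π, u, hπ, hπ1, hu, rfl⟩ := hf
  exact mix_nonneg (fun k j => HolderClass.isDensityI (hu k j)) hπ hx

theorem MixtureClass.ae_nonneg (hf : f ∈ MixtureClass L q m d) : 0 ≤ᵐ[volCube d] f :=
  (ae_volCube_mem d).mono fun _ hx => nonneg hf hx

theorem MixtureClass.integral_eq (hf : f ∈ MixtureClass L q m d) :
    ∫ x, f x ∂volCube d = 1 := by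
  obtain ⟨π, u, hπ, hπ1, hu, rfl⟩ := hf
  exact integral_mix (fun k j => HolderClass.isDensityI (hu k j)) hπ1

theorem sampleMeasure_eq (n : ℕ) (f : (Fin d → ℝ) → ℝ) : sampleMeasure n f =
    Measure.pi fun _ : Fin n => (volCube d).withDensity fun x => ENNReal.ofReal (f x) := by
  simp only [sampleMeasure, densityMeasure, restrict_unitCube]

theorem MixtureClass.isProbabilityMeasure_sampleMeasure (hf : f ∈ MixtureClass L q m d) :
    IsProbabilityMeasure (sampleMeasure n f) := by
  rw [sampleMeasure_eq]
  have := isProbabilityMeasure_withDensity_ofReal (integrable hf) (ae_nonneg hf) (integral_eq hf)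
  infer_instance

theorem MixtureClass.nonempty (hL : 0 ≤ L) (hm : 1 ≤ m) : (MixtureClass L q m d).Nonempty := by
  have hm0 : (m : ℝ) ≠ 0 := by positivity
  refine ⟨_, fun _ => 1 / m, fun _ _ _ => 1, fun k => by positivity, ?_,
    fun _ _ => one_mem_holderClass hL, rfl⟩
  simp [hm0]

theorem MixtureClass.minimaxRisk_le_one :
    minimaxRisk L q m d n (fun p₁ p₂ => tvDist p₁ p₂) ≤ 1 := by
  refine iInf_le_of_le (fun _ _ => 1) <| iInf_le_of_le measurable_const <|
    iInf_le_of_le (fun _ => ⟨fun _ _ => zero_le_one, ?_⟩) <| iSup₂_le fun f hf => ?_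
  · rw [restrict_unitCube]; simp
  have := isProbabilityMeasure_sampleMeasure (n := n) hf
  have htv : tvDist (fun _ => 1) f ≤ 1 := by
    rw [tvDist_eq]
    have h1 : ∫ x, |1 - f x| ∂volCube d ≤ ∫ x, (1 + f x) ∂volCube d := by
      refine integral_mono_ae ((integrable_const _).sub (integrable hf)).abs
        ((integrable_const _).add (integrable hf)) ?_
      filter_upwards [ae_nonneg hf] with x hx
      change 0 ≤ f x at hx
      rw [abs_le]
      constructor <;> linarith
    have h2 : ∫ x, (1 + f x) ∂volCube d = 2 := by
      rw [integral_add (integrable_const _) (integrable hf), integral_eq hf]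
      simp
      norm_num
    linarith
  have htv0 : 0 ≤ tvDist (fun _ => 1) f := by
    rw [tvDist_eq]
    exact mul_nonneg (by norm_num) (integral_nonneg fun _ => abs_nonneg _)
  calc _ ≤ ∫⁻ _, 1 ∂sampleMeasure n f := by
        refine lintegral_mono fun s => ?_
        rw [← ENNReal.ofReal_one]
        exact ENNReal.ofReal_le_ofReal (pow_le_one₀ htv0 htv)
    _ = 1 := by simp

theorem MixtureClass.minimaxRisk_le_of_net (hL : 0 ≤ L) (hm : 1 ≤ m) (hn : 1 ≤ n)
    {ι : Type} [Fintype ι] {p : ι → (Fin d → ℝ) → ℝ} (hpm : ∀ i, Measurable (p i))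
    (hp0 : ∀ i, ∀ x ∈ unitCube d, 0 ≤ p i x) (hp : ∀ i, Integrable (p i) (volCube d))
    (hp1 : ∀ i, ∫ x, p i x ∂volCube d = 1) {V ε : ℝ} (hV : 1 ≤ V)
    (hcard : (Fintype.card ι : ℝ) ^ 2 ≤ Real.exp V)
    (hnet : ∀ f ∈ MixtureClass L q m d, ∃ i, ∫ x, |p i x - f x| ∂volCube d ≤ ε) :
    minimaxRisk L q m d n (fun p₁ p₂ => tvDist p₁ p₂) ≤
      ENNReal.ofReal (13 * ε ^ 2 + 96 * V / n) := by
  classical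
  obtain ⟨f₀, hf₀⟩ := MixtureClass.nonempty (L := L) (q := q) (d := d) hL hm
  have : Nonempty ι := ⟨(hnet f₀ hf₀).choose⟩
  obtain ⟨idx, hidx, hrisk⟩ := exists_minimum_distance_selector hpm hp hp1 hn
  have hmeas : Measurable fun z : (Fin n → Fin d → ℝ) × (Fin d → ℝ) => p (idx z.1) z.2 := by
    have heq : (fun z : (Fin n → Fin d → ℝ) × (Fin d → ℝ) => p (idx z.1) z.2) =
        fun z => ∑ i, (Prod.fst ⁻¹' (idx ⁻¹' {i})).indicator (fun z => p i z.2) z := by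
      ext z
      rw [Finset.sum_eq_single (idx z.1)]
      · rw [Set.indicator_of_mem]; simp
      · intro i _ hi
        rw [Set.indicator_of_notMem]
        simpa using Ne.symm hi
      · simp
    rw [heq]
    exact Finset.measurable_fun_sum _ fun i _ =>
      ((hpm i).comp measurable_snd).indicator (measurable_fst (hidx i))
  refine iInf_le_of_le (fun s => p (idx s)) <| iInf_le_of_le hmeas <|
    iInf_le_of_le (fun s => ⟨hp0 _, ?_⟩) <| iSup₂_le fun f hf => ?_
  · rw [restrict_unitCube, hp1]
  obtain ⟨i, hi⟩ := hnet f hf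
  have h := hrisk f (integrable hf) (ae_nonneg hf) (integral_eq hf) V hV hcard i
  simp only [tvDist_eq, sampleMeasure_eq]
  refine h.trans (ENNReal.ofReal_le_ofReal ?_)
  have : 0 ≤ ∫ x, |p i x - f x| ∂volCube d := integral_nonneg fun _ => abs_nonneg _
  gcongr

end MixtureClass

theorem exists_minimaxRisk_le {q L : ℝ} (hq : 0 < q) (hL : 0 ≤ L) :
    ∃ C : ℝ, 0 < C ∧ ∀ m d n : ℕ, 1 ≤ m → 1 ≤ d → 1 ≤ n →
      minimaxRisk L q m d n (fun p₁ p₂ => tvDist p₁ p₂) ≤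
        ENNReal.ofReal (C * (m : ℝ) ^ (2 * q / (2 * q + 1)) *
          (d : ℝ) ^ ((2 * q + 2) / (2 * q + 1)) * (n : ℝ) ^ (-(2 * q / (2 * q + 1)))) := by
  obtain ⟨C, hC, hnet⟩ := exists_mixture_net hq hL
  refine ⟨13 * C ^ 2 + 192 * (2 * C + 1), by positivity, fun m d n hm hd hn => ?_⟩
  have hm1 : (1 : ℝ) ≤ m := by exact_mod_cast hm
  have hd1 : (1 : ℝ) ≤ d := by exact_mod_cast hd
  have hn1 : (1 : ℝ) ≤ n := by exact_mod_cast hn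
  have hm0 : (0 : ℝ) < m := by linarith
  have hd0 : (0 : ℝ) < d := by linarith
  have hn0 : (0 : ℝ) < n := by linarith
  have hq1 : 0 < 2 * q + 1 := by linarith
  set R : ℝ := (m : ℝ) ^ (2 * q / (2 * q + 1)) * (d : ℝ) ^ ((2 * q + 2) / (2 * q + 1)) *
    (n : ℝ) ^ (-(2 * q / (2 * q + 1))) with hR
  rw [mul_assoc _ ((m : ℝ) ^ _), mul_assoc, ← hR]
  set t : ℝ := d * n / m with ht
  have ht0 : 0 < t := by positivity
  have hR1 : R = d ^ 2 * t ^ (-(2 * q / (2 * q + 1))) := by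
    rw [ht, Real.div_rpow (by positivity) hm0.le, Real.mul_rpow hd0.le hn0.le,
      Real.rpow_neg hm0.le, div_inv_eq_mul, ← Real.rpow_natCast (d : ℝ) 2]
    have : (2 * q + 2) / (2 * q + 1) = ((2 : ℕ) : ℝ) + -(2 * q / (2 * q + 1)) := by
      push_cast; field_simp; ring
    rw [hR, this, Real.rpow_add hd0]
    ring
  have hR2 : R = m * d * t ^ (1 / (2 * q + 1)) / n := by
    rw [ht, Real.div_rpow (by positivity) hm0.le, Real.mul_rpow hd0.le hn0.le]
    have e1 : 2 * q / (2 * q + 1) = 1 - 1 / (2 * q + 1) := by field_simp; ring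
    have e2 : (2 * q + 2) / (2 * q + 1) = 1 + 1 / (2 * q + 1) := by field_simp; ring
    rw [hR, e1, e2, neg_sub, Real.rpow_add hd0, Real.rpow_sub hm0, Real.rpow_sub hn0,
      Real.rpow_one, Real.rpow_one, Real.rpow_one]
    field_simp
  have hR0 : 0 < R := by positivity
  rcases lt_or_ge t 1 with h1 | h1
  · refine MixtureClass.minimaxRisk_le_one.trans ?_
    rw [← ENNReal.ofReal_one]
    refine ENNReal.ofReal_le_ofReal ?_
    have : 1 ≤ R := by
      rw [hR1]
      have h2 : 1 ≤ t ^ (-(2 * q / (2 * q + 1))) :=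
        Real.one_le_rpow_of_pos_of_le_one_of_nonpos ht0 h1.le (by
          rw [neg_nonpos]; positivity)
      nlinarith
    nlinarith [sq_nonneg C]
  · set N := ⌈t ^ (1 / (2 * q + 1))⌉₊ with hN
    have hte : 1 ≤ t ^ (1 / (2 * q + 1)) := Real.one_le_rpow h1 (by positivity)
    have hNle : t ^ (1 / (2 * q + 1)) ≤ N := Nat.le_ceil _
    have hNle' : (N : ℝ) ≤ 2 * t ^ (1 / (2 * q + 1)) := by
      have := Nat.ceil_lt_add_one (a := t ^ (1 / (2 * q + 1))) (by positivity)
      linarith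
    have hN1 : 1 ≤ N := by
      have : (1 : ℝ) ≤ N := hte.trans hNle
      exact_mod_cast this
    have hN1' : (1 : ℝ) ≤ N := by exact_mod_cast hN1
    obtain ⟨ι, _, p, hpm, hp0, hp, hp1, hcard, hcov⟩ := hnet m d N hm hd hN1
    refine (MixtureClass.minimaxRisk_le_of_net hL hm hn hpm hp0 hp hp1
      (V := 2 * (C * (m * d * N)) + 1) (le_add_of_nonneg_left (by positivity)) ?_ hcov).trans ?_
    · calc (Fintype.card ι : ℝ) ^ 2 ≤ Real.exp (C * (m * d * N)) ^ 2 := by gcongr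
        _ = Real.exp (2 * (C * (m * d * N))) := by rw [← Real.exp_nat_mul]; norm_num
        _ ≤ _ := Real.exp_le_exp.2 (by linarith)
    · refine ENNReal.ofReal_le_ofReal ?_
      have hb : (d * (N : ℝ) ^ (-q)) ^ 2 ≤ R := by
        rw [hR1, mul_pow]
        gcongr
        calc ((N : ℝ) ^ (-q)) ^ 2 ≤ ((t ^ (1 / (2 * q + 1))) ^ (-q)) ^ 2 := by
              gcongr ?_ ^ 2
              exact Real.rpow_le_rpow_of_nonpos (by positivity) hNle (by linarith)
          _ = t ^ (-(2 * q / (2 * q + 1))) := by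
              rw [← Real.rpow_natCast, ← Real.rpow_mul ht0.le, ← Real.rpow_mul ht0.le]
              congr 1
              push_cast
              field_simp
      have hv : (m * d * N : ℝ) / n ≤ 2 * R := by
        rw [hR2]
        calc (m * d * N : ℝ) / n ≤ m * d * (2 * t ^ (1 / (2 * q + 1))) / n := by gcongr
          _ = _ := by ring
      have hv1 : 1 / (n : ℝ) ≤ 2 * R := by
        refine le_trans ?_ hv
        gcongr
        nlinarith [mul_le_mul hm1 hd1 zero_le_one hm0.le]
      calc 13 * (C * (d * (N : ℝ) ^ (-q))) ^ 2 + 96 * (2 * (C * (m * d * N)) + 1) / n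
          = 13 * C ^ 2 * (d * (N : ℝ) ^ (-q)) ^ 2 + 96 * (2 * C * (m * d * N / n) + 1 / n) := by
            ring
        _ ≤ 13 * C ^ 2 * R + 96 * (2 * C * (2 * R) + 2 * R) := by gcongr
        _ = _ := by ring

/-- A mean-zero bump supported in `(0,1)` whose `holderInt q`-th derivative is Hölder continuous
with exponent `q - holderInt q` and constant `M`. -/
structure IsHolderBump (q M : ℝ) (ψ : ℝ → ℝ) : Prop where
  contDiff : ContDiff ℝ (holderInt q) ψ
  abs_le_one : ∀ x, |ψ x| ≤ 1
  eq_zero : ∀ x ∉ Set.Ioo (0 : ℝ) 1, ψ x = 0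
  iteratedDeriv_eq_zero : ∀ x ∉ Set.Ioo (0 : ℝ) 1, iteratedDeriv (holderInt q) ψ x = 0
  integral_eq_zero : ∫ x, ψ x = 0
  integral_abs_pos : 0 < ∫ x, |ψ x|
  const_nonneg : 0 ≤ M
  holder : ∀ x y, |iteratedDeriv (holderInt q) ψ x - iteratedDeriv (holderInt q) ψ y| ≤
    M * |x - y| ^ (q - holderInt q)

theorem exists_isHolderBump {q : ℝ} (hq : 0 < q) : ∃ M ψ, IsHolderBump q M ψ := by
  let b : ContDiffBump (0 : ℝ) := ⟨1 / 16, 1 / 8, by norm_num, by norm_num⟩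
  let ψ : ℝ → ℝ := fun x => b (x - 1 / 4) - b (x - 3 / 4)
  have hb0 : ∀ x : ℝ, 1 / 8 ≤ |x| → b x = 0 := fun x hx =>
    b.zero_of_le_dist (by simpa [b, Real.dist_eq] using hx)
  have hψ : ContDiff ℝ ((holderInt q : ℕ) + 1 : ℕ) ψ :=
    (b.contDiff.comp (contDiff_id.sub contDiff_const)).sub
      (b.contDiff.comp (contDiff_id.sub contDiff_const))
  have hzero : ∀ x ∉ Set.Icc (1 / 8 : ℝ) (7 / 8), ψ x = 0 := by
    intro x hx
    have h1 : 1 / 8 ≤ |x - 1 / 4| ∧ 1 / 8 ≤ |x - 3 / 4| := by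
      rw [Set.mem_Icc, not_and_or, not_le, not_le] at hx
      rcases hx with hx | hx
      · exact ⟨le_abs.2 (Or.inr (by linarith)), le_abs.2 (Or.inr (by linarith))⟩
      · exact ⟨le_abs.2 (Or.inl (by linarith)), le_abs.2 (Or.inl (by linarith))⟩
    simp only [ψ, hb0 _ h1.1, hb0 _ h1.2, sub_zero]
  have htsupp : tsupport ψ ⊆ Set.Icc (1 / 8 : ℝ) (7 / 8) :=
    closure_minimal (Function.support_subset_iff'.2 hzero) isClosed_Icc
  have hIoo : ∀ x ∉ Set.Ioo (0 : ℝ) 1, x ∉ Set.Icc (1 / 8 : ℝ) (7 / 8) := fun x hx h =>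
    hx ⟨by linarith [h.1], by linarith [h.2]⟩
  have hcomp : HasCompactSupport ψ := HasCompactSupport.intro isCompact_Icc hzero
  have hg_int : ∀ c, Integrable (fun x => b (x - c)) := fun c => b.integrable.comp_sub_right c
  have hDzero : ∀ x ∉ Set.Icc (1 / 8 : ℝ) (7 / 8), iteratedDeriv (holderInt q) ψ x = 0 := by
    intro x hx
    have : iteratedFDeriv ℝ (holderInt q) ψ x = 0 := by
      by_contra h
      exact hx (htsupp (support_iteratedFDeriv_subset (holderInt q) h))
    rw [iteratedDeriv_eq_iteratedFDeriv, this]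
    rfl
  have hDcomp : HasCompactSupport (iteratedDeriv (holderInt q) ψ) :=
    HasCompactSupport.intro isCompact_Icc hDzero
  have hDdiff : ContDiff ℝ 1 (iteratedDeriv (holderInt q) ψ) := by
    rw [iteratedDeriv_eq_iterate]
    refine ContDiff.iterate_deriv' 1 (holderInt q) ?_
    rw [add_comm]
    exact_mod_cast hψ
  obtain ⟨K, hK⟩ := ContDiff.lipschitzWith_of_hasCompactSupport hDcomp hDdiff one_ne_zero
  obtain ⟨B, hB⟩ := hDcomp.exists_bound_of_continuous hDdiff.continuous
  have hβ0 : 0 ≤ q - holderInt q := by linarith [holderInt_lt hq]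
  have hβ1 : q - holderInt q ≤ 1 := by linarith [le_holderInt_add_one hq]
  refine ⟨max (K : ℝ) (2 * B), ψ, hψ.of_le (by norm_cast; omega), fun x => ?_,
    fun x hx => hzero x (hIoo x hx), fun x hx => hDzero x (hIoo x hx), ?_, ?_,
    le_max_of_le_left K.2, fun x y => ?_⟩
  · have h1 := b.nonneg (x := x - 1 / 4)
    have h2 := b.nonneg (x := x - 3 / 4)
    have h3 := b.le_one (x := x - 1 / 4)
    have h4 := b.le_one (x := x - 3 / 4)
    simp only [ψ, abs_le]
    constructor <;> linarith
  · simp only [ψ]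
    rw [integral_sub (hg_int _) (hg_int _), integral_sub_right_eq_self b,
      integral_sub_right_eq_self b, sub_self]
  · have hcont : Continuous fun x => |ψ x| := hψ.continuous.abs
    refine hcont.integral_pos_of_hasCompactSupport_nonneg_nonzero hcomp.abs
      (fun x => abs_nonneg _) (x := 1 / 4) ?_
    have h1 : b (1 / 4 - 1 / 4 : ℝ) = 1 := by
      apply b.one_of_mem_closedBall
      simp [b]
    have h2 : b (1 / 4 - 3 / 4 : ℝ) = 0 := hb0 _ (by norm_num [abs_of_neg])
    simp only [ψ, h1, h2]
    norm_num
  · rcases le_total |x - y| 1 with h | h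
    · calc _ ≤ (K : ℝ) * |x - y| := by
            simpa [Real.dist_eq] using hK.dist_le_mul x y
        _ ≤ (K : ℝ) * |x - y| ^ (q - holderInt q) := by
            gcongr
            exact Real.self_le_rpow_of_le_one (abs_nonneg _) h hβ1
        _ ≤ _ := by gcongr; exact le_max_left _ _
    · have hx := hB x
      have hy := hB y
      rw [Real.norm_eq_abs] at hx hy
      have h1 : 1 ≤ |x - y| ^ (q - holderInt q) := Real.one_le_rpow h hβ0
      have hM : 0 ≤ max (K : ℝ) (2 * B) := le_max_of_le_left K.2
      calc _ ≤ 2 * B := (abs_sub _ _).trans (by linarith)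
        _ ≤ max (K : ℝ) (2 * B) := le_max_right _ _
        _ ≤ _ := le_mul_of_one_le_right hM h1

theorem sum_fin_eq_intCast_le_one (H : ℕ) (z : ℤ) :
    ∑ i : Fin H, (if (i : ℤ) = z then (1 : ℝ) else 0) ≤ 1 := by
  rw [Finset.sum_boole]
  norm_cast
  refine Finset.card_le_one.2 fun i hi j hj => ?_
  simp only [Finset.mem_filter, Finset.mem_univ, true_and] at hi hj
  exact Fin.ext (by omega)

theorem abs_sum_shift_sub_le {H : ℕ} {g : ℝ → ℝ} (hg : ∀ x ∉ Set.Ioo (0 : ℝ) 1, g x = 0)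
    {ε : Fin H → ℝ} (hε : ∀ i, |ε i| ≤ 1) {x y K : ℝ} (hK0 : 0 ≤ K)
    (hK : ∀ i : Fin H, |g (x - i) - g (y - i)| ≤ K) :
    |∑ i, ε i * g (x - i) - ∑ i, ε i * g (y - i)| ≤ 2 * K := by
  have hfl : ∀ (z : ℝ) (i : Fin H), (i : ℤ) ≠ ⌊z⌋ → g (z - i) = 0 := by
    intro z i hi
    refine hg _ fun h => hi ?_
    symm
    rw [Int.floor_eq_iff]
    push_cast
    constructor <;> linarith [h.1, h.2]
  rw [← Finset.sum_sub_distrib]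
  calc _ ≤ ∑ i : Fin H, (K * (if (i : ℤ) = ⌊x⌋ then (1 : ℝ) else 0) +
        K * (if (i : ℤ) = ⌊y⌋ then (1 : ℝ) else 0)) := by
        refine (Finset.abs_sum_le_sum_abs _ _).trans (Finset.sum_le_sum fun i _ => ?_)
        rw [← mul_sub, abs_mul]
        have h1 : |ε i| * |g (x - i) - g (y - i)| ≤ K :=
          (mul_le_of_le_one_left (abs_nonneg _) (hε i)).trans (hK i)
        by_cases hx : (i : ℤ) = ⌊x⌋
        · rw [if_pos hx]
          split_ifs <;> linarith
        · by_cases hy : (i : ℤ) = ⌊y⌋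
          · rw [if_pos hy, if_neg hx]
            linarith
          · rw [hfl x i hx, hfl y i hy]
            simp [hx, hy]
    _ ≤ 2 * K := by
        rw [Finset.sum_add_distrib, ← Finset.mul_sum, ← Finset.mul_sum]
        nlinarith [sum_fin_eq_intCast_le_one H ⌊x⌋, sum_fin_eq_intCast_le_one H ⌊y⌋]

namespace IsHolderBump

variable {q M : ℝ} {ψ : ℝ → ℝ} {H : ℕ}

theorem mem_Ioo_of_ne_zero (hψ : IsHolderBump q M ψ) (hH : 0 < H) {i : Fin H} {x : ℝ}
    (hx : ψ (H * x - i) ≠ 0) : x ∈ Set.Ioo (i / H : ℝ) ((i + 1) / H) := by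
  have h : (H * x - i : ℝ) ∈ Set.Ioo (0 : ℝ) 1 := by
    by_contra h
    exact hx (hψ.eq_zero _ h)
  have hH0 : (0 : ℝ) < H := by exact_mod_cast hH
  exact ⟨by rw [div_lt_iff₀ hH0]; linarith [h.1], by rw [lt_div_iff₀ hH0]; linarith [h.2]⟩

theorem cell_subset_Icc (hH : 0 < H) (i : Fin H) :
    Set.Ioo (i / H : ℝ) ((i + 1) / H) ⊆ Set.Icc 0 1 := by
  have hH0 : (0 : ℝ) < H := by exact_mod_cast hH
  have hi : ((i : ℕ) + 1 : ℝ) ≤ H := by exact_mod_cast i.2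
  refine fun x hx => ⟨le_trans (by positivity) hx.1.le, hx.2.le.trans ?_⟩
  rwa [div_le_one hH0]

theorem setIntegral_comp (hψ : IsHolderBump q M ψ) (hH : 0 < H) (i : Fin H) {φ : ℝ → ℝ}
    (hφ : φ 0 = 0) :
    ∫ x in Set.Icc (0 : ℝ) 1, φ (ψ (H * x - i)) = (H : ℝ)⁻¹ * ∫ x, φ (ψ x) := by
  rw [setIntegral_eq_integral_of_forall_compl_eq_zero,
    Measure.integral_comp_mul_left (fun y => φ (ψ (y - i))) (H : ℝ),
    integral_sub_right_eq_self (fun y => φ (ψ y)), abs_of_nonneg (by positivity), smul_eq_mul]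
  intro x hx
  have : ψ (H * x - i) = 0 := by
    by_contra h
    exact hx (cell_subset_Icc hH i (hψ.mem_Ioo_of_ne_zero hH h))
  rw [this, hφ]

theorem continuous (hψ : IsHolderBump q M ψ) : Continuous ψ := hψ.contDiff.continuous

theorem abs_sum_le (hψ : IsHolderBump q M ψ) {ε : Fin H → ℝ} (hε : ∀ i, |ε i| ≤ 1) (x : ℝ) :
    |∑ i, ε i * ψ (x - i)| ≤ 1 := by
  have hfl : ∀ i : Fin H, (i : ℤ) ≠ ⌊x⌋ → ψ (x - i) = 0 := by
    intro i hi
    refine hψ.eq_zero _ fun h => hi ?_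
    symm
    rw [Int.floor_eq_iff]
    push_cast
    constructor <;> linarith [h.1, h.2]
  refine (Finset.abs_sum_le_sum_abs _ _).trans
    (le_trans (Finset.sum_le_sum fun i _ => ?_) (sum_fin_eq_intCast_le_one H ⌊x⌋))
  rw [abs_mul]
  by_cases hi : (i : ℤ) = ⌊x⌋
  · rw [if_pos hi]
    exact mul_le_one₀ (hε i) (abs_nonneg _) (hψ.abs_le_one _)
  · rw [if_neg hi, hfl i hi, abs_zero, mul_zero]

/-- The uniform density perturbed by rescaled bumps belongs to the Hölder class. -/
theorem perturb_mem_holderClass (hψ : IsHolderBump q M ψ) (hH : 0 < H)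
    {L a : ℝ} (ha0 : 0 ≤ a) (ha1 : a ≤ 1) (haL : 2 * (a * H ^ q) * M ≤ L)
    {ε : Fin H → ℝ} (hε : ∀ i, |ε i| ≤ 1) :
    (fun x : ℝ => 1 + ∑ i, ε i * (a * ψ (H * x - i))) ∈ HolderClass L q := by
  have hH0 : (0 : ℝ) < H := by exact_mod_cast hH
  set l := holderInt q with hl
  set S : ℝ → ℝ := fun y => ∑ i, ε i * ψ (y - i) with hS
  have hfS : (fun x : ℝ => 1 + ∑ i, ε i * (a * ψ (H * x - i))) = fun x => 1 + a * S (H * x) := by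
    ext x
    rw [hS, Finset.mul_sum]
    congr 1
    exact Finset.sum_congr rfl fun i _ => by ring
  have hterm : ∀ i : Fin H, ContDiff ℝ l fun y => ε i * ψ (y - i) := fun i =>
    contDiff_const.mul (hψ.contDiff.comp (contDiff_id.sub contDiff_const))
  have hSd : ContDiff ℝ l S := ContDiff.sum fun i _ => hterm i
  have hSder : ∀ y, iteratedDeriv l S y = ∑ i, ε i * iteratedDeriv l ψ (y - i) := by
    intro y
    rw [hS, iteratedDeriv_fun_sum fun i _ => (hterm i).contDiffAt]
    refine Finset.sum_congr rfl fun i _ => ?_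
    rw [iteratedDeriv_const_mul_field, iteratedDeriv_comp_sub_const]
  have hScd : ContDiff ℝ l fun x : ℝ => a * S (H * x) :=
    contDiff_const.mul (hSd.comp (contDiff_const.mul contDiff_id))
  have hfd : ContDiff ℝ l fun x : ℝ => 1 + a * S (H * x) := contDiff_const.add hScd
  have hder : ∀ x ∈ Set.Icc (0 : ℝ) 1, iteratedDerivWithin l (fun x : ℝ => 1 + a * S (H * x))
      (Set.Icc 0 1) x = iteratedDeriv l (fun _ : ℝ => (1 : ℝ)) 0 +
        a * (H ^ l * ∑ i, ε i * iteratedDeriv l ψ (H * x - i)) := by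
    intro x hx
    rw [iteratedDerivWithin_eq_iteratedDeriv (uniqueDiffOn_Icc zero_lt_one) hfd.contDiffAt hx,
      iteratedDeriv_fun_add contDiffAt_const hScd.contDiffAt,
      iteratedDeriv_const_mul_field, iteratedDeriv_comp_const_mul hSd]
    simp only [hSder, iteratedDeriv_const]
  rw [hfS]
  refine ⟨fun x _ => ?_, ?_, hfd.contDiffOn, fun x hx y hy => ?_⟩
  · have h := hψ.abs_sum_le hε (H * x)
    rw [abs_le] at h
    have : -1 ≤ S (H * x) := h.1
    nlinarith
  · have hg_int : ∀ i : Fin H, IntegrableOn (fun x : ℝ => ε i * (a * ψ (H * x - i)))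
        (Set.Icc 0 1) := fun i => by
      have := hψ.continuous
      exact Continuous.integrableOn_Icc (by fun_prop)
    rw [← hfS, integral_add (by simp) (integrable_finsetSum _ fun i _ => hg_int i),
      integral_finsetSum _ fun i _ => hg_int i]
    have h0 : ∀ i : Fin H, ∫ x in Set.Icc (0 : ℝ) 1, ε i * (a * ψ (H * x - i)) = 0 := by
      intro i
      have := hψ.setIntegral_comp hH i (φ := id) rfl
      simp only [id, hψ.integral_eq_zero, mul_zero] at this
      rw [integral_const_mul, integral_const_mul, this, mul_zero, mul_zero]
    simp [h0]
  · rw [hder x hx, hder y hy, add_sub_add_left_eq_sub, ← mul_sub, ← mul_sub, abs_mul, abs_mul,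
      abs_of_nonneg ha0, abs_of_nonneg (by positivity : (0 : ℝ) ≤ (H : ℝ) ^ l)]
    have hsc : ∀ i : Fin H, |iteratedDeriv l ψ (H * x - i) - iteratedDeriv l ψ (H * y - i)| ≤
        M * (H ^ (q - l) * |x - y| ^ (q - l)) := by
      intro i
      refine (hψ.holder _ _).trans (le_of_eq ?_)
      rw [sub_sub_sub_cancel_right, ← mul_sub, abs_mul, abs_of_pos hH0,
        Real.mul_rpow hH0.le (abs_nonneg _)]
    have hM := hψ.const_nonneg
    have hsum := abs_sum_shift_sub_le hψ.iteratedDeriv_eq_zero hε (by positivity) hsc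
    have hHq : (H : ℝ) ^ l * (H : ℝ) ^ (q - l) = (H : ℝ) ^ q := by
      rw [← Real.rpow_natCast, ← Real.rpow_add hH0]
      congr 1
      ring
    calc _ ≤ a * ((H : ℝ) ^ l * (2 * (M * (H ^ (q - l) * |x - y| ^ (q - l))))) := by gcongr
      _ = 2 * (a * ((H : ℝ) ^ l * (H : ℝ) ^ (q - l))) * M * |x - y| ^ (q - l) := by ring
      _ ≤ _ := by
          rw [hHq]
          gcongr

end IsHolderBump

section Assouad

variable {X : Type*} [MeasurableSpace X] {μ : Measure X}

theorem pi_withDensity_ofReal [IsProbabilityMeasure μ] {f : X → ℝ} (hf : Integrable f μ) (hf0 : ∀ x, 0 ≤ f x) (n : ℕ) :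
    (Measure.pi fun _ : Fin n => μ.withDensity fun x => ENNReal.ofReal (f x)) =
      (Measure.pi fun _ : Fin n => μ).withDensity fun s => ENNReal.ofReal (∏ r, f (s r)) := by
  have := isFiniteMeasure_withDensity_ofReal hf.2
  refine Measure.pi_eq (μ := fun _ : Fin n => μ.withDensity fun x => ENNReal.ofReal (f x))
    fun B hB => ?_
  rw [withDensity_apply _ (MeasurableSet.univ_pi hB), Measure.restrict_pi_pi,
    ← ofReal_integral_eq_lintegral_ofReal (Integrable.fintype_prod fun r => hf.integrableOn)
      (Filter.Eventually.of_forall fun s => Finset.prod_nonneg fun r _ => hf0 _),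
    integral_fintype_prod_eq_prod (fun _ => f),
    ENNReal.ofReal_prod_of_nonneg fun r _ => integral_nonneg hf0]
  refine Finset.prod_congr rfl fun r _ => ?_
  rw [withDensity_apply _ (hB r),
    ofReal_integral_eq_lintegral_ofReal hf.integrableOn (Filter.Eventually.of_forall hf0)]

/-- The sign encoded by a Boolean. -/
def boolSign (b : Bool) : ℝ := if b then 1 else -1

theorem boolSign_not (b : Bool) : boolSign (!b) = -boolSign b := by cases b <;> simp [boolSign]

theorem boolSign_sq (b : Bool) : boolSign b ^ 2 = 1 := by cases b <;> simp [boolSign]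

theorem abs_boolSign (b : Bool) : |boolSign b| = 1 := by cases b <;> simp [boolSign]

/-- The uniform density perturbed by the functions `g i` with signs `ω i`. -/
def perturb {H : ℕ} (g : Fin H → X → ℝ) (ω : Fin H → Bool) (x : X) : ℝ :=
  1 + ∑ i, boolSign (ω i) * g i x

/-- Mean-zero perturbations `g i` living on the disjoint cells `A i`, all of the same `L¹`-norm `γ`,
that cannot be detected from `n` observations. -/
structure IsPerturbation (μ : Measure X) (n : ℕ) (γ : ℝ) {H : ℕ} (A : Fin H → Set X)
    (g : Fin H → X → ℝ) : Prop where
  measurable : ∀ i, Measurable (g i)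
  measurableSet : ∀ i, MeasurableSet (A i)
  disjoint : Pairwise (Function.onFun Disjoint A)
  eq_zero : ∀ i, ∀ x ∉ A i, g i x = 0
  abs_le_half : ∀ i x, |g i x| ≤ 1 / 2
  integral_eq_zero : ∀ i, ∫ x, g i x ∂μ = 0
  integral_abs : ∀ i, ∫ x, |g i x| ∂μ = γ
  integral_sq_le : ∀ i, n * ∫ x, g i x ^ 2 ∂μ ≤ 1 / 2

namespace IsPerturbation

variable {n H : ℕ} {γ : ℝ} {A : Fin H → Set X} {g : Fin H → X → ℝ}

theorem perturb_of_mem (hg : IsPerturbation μ n γ A g) (ω : Fin H → Bool) {i : Fin H} {x : X}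
    (hx : x ∈ A i) : perturb g ω x = 1 + boolSign (ω i) * g i x := by
  rw [perturb, Finset.sum_eq_single i]
  · intro j _ hj
    rw [hg.eq_zero j x fun h => (Set.disjoint_left.1 (hg.disjoint hj) h) hx, mul_zero]
  · simp

theorem abs_perturb_sub_one_le (hg : IsPerturbation μ n γ A g) (ω : Fin H → Bool) (x : X) :
    |perturb g ω x - 1| ≤ 1 / 2 := by
  by_cases h : ∃ i, x ∈ A i
  · obtain ⟨i, hi⟩ := h
    rw [hg.perturb_of_mem ω hi, add_sub_cancel_left, abs_mul, abs_boolSign, one_mul]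
    exact hg.abs_le_half i x
  · push Not at h
    rw [perturb, add_sub_cancel_left, Finset.sum_eq_zero]
    · norm_num
    · intro i _
      rw [hg.eq_zero i x (h i), mul_zero]

theorem perturb_nonneg (hg : IsPerturbation μ n γ A g) (ω : Fin H → Bool) (x : X) :
    0 ≤ perturb g ω x := by
  have := abs_le.1 (hg.abs_perturb_sub_one_le ω x)
  linarith [this.1]

theorem measurable_perturb (hg : IsPerturbation μ n γ A g) (ω : Fin H → Bool) :
    Measurable (perturb g ω) :=
  measurable_const.add <| Finset.measurable_fun_sum _ fun i _ => (hg.measurable i).const_mul _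

theorem perturb_update_of_mem (hg : IsPerturbation μ n γ A g) (ω : Fin H → Bool) {i : Fin H}
    {x : X} (hx : x ∈ A i) :
    perturb g (Function.update ω i (!ω i)) x = 1 - boolSign (ω i) * g i x := by
  rw [hg.perturb_of_mem _ hx, Function.update_self, boolSign_not]
  ring

theorem perturb_update_of_notMem (hg : IsPerturbation μ n γ A g) (ω : Fin H → Bool) {i : Fin H}
    {x : X} (hx : x ∉ A i) :
    perturb g (Function.update ω i (!ω i)) x = perturb g ω x := by
  unfold perturb
  congr 1
  refine Finset.sum_congr rfl fun j _ => ?_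
  by_cases h : j = i
  · subst h
    rw [hg.eq_zero j x hx, mul_zero, mul_zero]
  · rw [Function.update_of_ne h]

/-- The `L¹`-distance over the cell `A i` between `T s` and the perturbed density with sign `b`. -/
noncomputable def cellDist (μ : Measure X) (A : Fin H → Set X) (g : Fin H → X → ℝ)
    {S : Type*} (T : S → X → ℝ) (i : Fin H) (b : Bool) (s : S) : ℝ≥0∞ :=
  ∫⁻ x in A i, ENNReal.ofReal |T s x - (1 + boolSign b * g i x)| ∂μ

theorem sum_cellDist_le (hg : IsPerturbation μ n γ A g) {S : Type*} (T : S → X → ℝ)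
    (ω : Fin H → Bool) (s : S) :
    ∑ i, cellDist μ A g T i (ω i) s ≤ ∫⁻ x, ENNReal.ofReal |T s x - perturb g ω x| ∂μ := by
  calc ∑ i, cellDist μ A g T i (ω i) s
      = ∑ i, ∫⁻ x in A i, ENNReal.ofReal |T s x - perturb g ω x| ∂μ := by
        refine Finset.sum_congr rfl fun i _ => setLIntegral_congr_fun (hg.measurableSet i) ?_
        intro x hx
        simp only [hg.perturb_of_mem ω hx]
    _ = ∫⁻ x in ⋃ i ∈ (Finset.univ : Finset (Fin H)), A i,
          ENNReal.ofReal |T s x - perturb g ω x| ∂μ :=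
        (lintegral_biUnion_finset (fun i _ j _ hij => hg.disjoint hij)
          (fun i _ => hg.measurableSet i) _).symm
    _ ≤ _ := setLIntegral_le_lintegral _ _

variable [IsProbabilityMeasure μ]

theorem integrable (hg : IsPerturbation μ n γ A g) (i : Fin H) : Integrable (g i) μ :=
  Integrable.of_bound (hg.measurable i).aestronglyMeasurable (1 / 2)
    (Filter.Eventually.of_forall (hg.abs_le_half i))

theorem integrable_sq (hg : IsPerturbation μ n γ A g) (i : Fin H) :
    Integrable (fun x => g i x ^ 2) μ := by
  refine Integrable.of_bound ((hg.measurable i).pow_const 2).aestronglyMeasurable ((1 / 2) ^ 2)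
    (Filter.Eventually.of_forall fun x => ?_)
  rw [norm_pow]
  exact pow_le_pow_left₀ (norm_nonneg _) (hg.abs_le_half i x) 2

theorem integrable_perturb (hg : IsPerturbation μ n γ A g) (ω : Fin H → Bool) :
    Integrable (perturb g ω) μ :=
  (integrable_const _).add <| integrable_finsetSum _ fun i _ => (hg.integrable i).const_mul _

theorem integral_perturb (hg : IsPerturbation μ n γ A g) (ω : Fin H → Bool) :
    ∫ x, perturb g ω x ∂μ = 1 := by
  unfold perturb
  rw [integral_add (integrable_const _)
    (integrable_finsetSum _ fun i _ => (hg.integrable i).const_mul _),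
    integral_finsetSum _ fun i _ => (hg.integrable i).const_mul _]
  simp [integral_const_mul, hg.integral_eq_zero]

theorem integrable_prod_perturb (hg : IsPerturbation μ n γ A g) (ω : Fin H → Bool) :
    Integrable (fun s : Fin n → X => ∏ r, perturb g ω (s r)) (Measure.pi fun _ => μ) :=
  Integrable.fintype_prod fun _ => hg.integrable_perturb ω

theorem integral_prod_perturb (hg : IsPerturbation μ n γ A g) (ω : Fin H → Bool) :
    ∫ s : Fin n → X, ∏ r, perturb g ω (s r) ∂(Measure.pi fun _ => μ) = 1 := by
  rw [integral_fintype_prod_eq_prod (fun _ => perturb g ω)]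
  simp [hg.integral_perturb]

/-- Flipping one sign leaves an overlap bounded from below between the laws of the samples. -/
theorem le_integral_min (hg : IsPerturbation μ n γ A g) (ω : Fin H → Bool) (i : Fin H) :
    1 / 8 ≤ ∫ s : Fin n → X, min (∏ r, perturb g ω (s r))
      (∏ r, perturb g (Function.update ω i (!ω i)) (s r)) ∂(Measure.pi fun _ => μ) := by
  set f := perturb g ω with hf
  set f' := perturb g (Function.update ω i (!ω i)) with hf'
  have hfi : Integrable f μ := hg.integrable_perturb _
  have hfi' : Integrable f' μ := hg.integrable_perturb _
  set w : X → ℝ := fun x => (f x + f' x) / 2 - g i x ^ 2 with hw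
  have hw0 : ∀ x, 0 ≤ w x := by
    intro x
    have h1 := (abs_le.1 (hg.abs_perturb_sub_one_le ω x)).1
    have h2 := (abs_le.1 (hg.abs_perturb_sub_one_le (Function.update ω i (!ω i)) x)).1
    have h3 := abs_le.1 (hg.abs_le_half i x)
    simp only [hw, hf, hf']
    nlinarith [h3.1, h3.2]
  have hw2 : ∀ x, w x ^ 2 ≤ f x * f' x := by
    intro x
    by_cases hx : x ∈ A i
    · have h3 := abs_le.1 (hg.abs_le_half i x)
      have hs := boolSign_sq (ω i)
      have e1 : w x = 1 - g i x ^ 2 := by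
        simp only [hw, hf, hf', hg.perturb_of_mem ω hx, hg.perturb_update_of_mem ω hx]
        ring
      have e2 : f x * f' x = 1 - g i x ^ 2 := by
        simp only [hf, hf', hg.perturb_of_mem ω hx, hg.perturb_update_of_mem ω hx]
        linear_combination (-(g i x ^ 2)) * hs
      rw [e1, e2]
      have h4 : g i x ^ 2 ≤ 1 := by nlinarith [h3.1, h3.2]
      nlinarith [sq_nonneg (g i x)]
    · simp only [hw, hf, hf', hg.eq_zero i x hx, hg.perturb_update_of_notMem ω hx]
      nlinarith
  have hffi : Integrable (fun x => (f x + f' x) / 2) μ := (hfi.add hfi').div_const 2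
  have hwi : Integrable w μ := hffi.sub (hg.integrable_sq i)
  have hwint : ∫ x, w x ∂μ = 1 - ∫ x, g i x ^ 2 ∂μ := by
    simp only [hw]
    rw [integral_sub hffi (hg.integrable_sq i), integral_div,
      integral_add hfi hfi', hf, hf', hg.integral_perturb, hg.integral_perturb]
    norm_num
  have hWint : 1 / 2 ≤ ∫ s : Fin n → X, ∏ r, w (s r) ∂(Measure.pi fun _ => μ) := by
    rw [integral_fintype_prod_eq_prod (fun _ => w), Finset.prod_const, hwint, Finset.card_univ,
      Fintype.card_fin]
    have hle : ∫ x, g i x ^ 2 ∂μ ≤ 1 := by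
      calc ∫ x, g i x ^ 2 ∂μ ≤ ∫ _, 1 ∂μ :=
            integral_mono (hg.integrable_sq i) (integrable_const _) fun x => by
              have h3 := abs_le.1 (hg.abs_le_half i x)
              change g i x ^ 2 ≤ 1
              nlinarith [h3.1, h3.2]
        _ = 1 := by simp
    have := one_add_mul_le_pow (a := -∫ x, g i x ^ 2 ∂μ) (by linarith) n
    rw [← sub_eq_add_neg] at this
    linarith [hg.integral_sq_le i]
  set P : (Fin n → X) → ℝ := fun s => ∏ r, f (s r) with hP
  set P' : (Fin n → X) → ℝ := fun s => ∏ r, f' (s r) with hP'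
  have hPi : Integrable P (Measure.pi fun _ => μ) := hg.integrable_prod_perturb _
  have hPi' : Integrable P' (Measure.pi fun _ => μ) := hg.integrable_prod_perturb _
  have hpt : ∀ s, ∏ r, w (s r) ≤ (P s + P' s) / 8 + 2 * min (P s) (P' s) := by
    intro s
    have hP0 : 0 ≤ P s := Finset.prod_nonneg fun r _ => hg.perturb_nonneg _ _
    have hP0' : 0 ≤ P' s := Finset.prod_nonneg fun r _ => hg.perturb_nonneg _ _
    have hW2 : (∏ r, w (s r)) ^ 2 ≤ P s * P' s := by
      rw [← Finset.prod_pow, hP, hP']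
      simp only
      rw [← Finset.prod_mul_distrib]
      exact Finset.prod_le_prod (fun r _ => sq_nonneg _) fun r _ => hw2 _
    rcases le_total (P s) (P' s) with h | h
    · rw [min_eq_left h]
      refine abs_le_of_sq_le_sq' (hW2.trans ?_) (by positivity) |>.2
      nlinarith [sq_nonneg (P' s / 8 - 2 * P s), mul_nonneg hP0 hP0', mul_nonneg hP0 hP0]
    · rw [min_eq_right h]
      refine abs_le_of_sq_le_sq' (hW2.trans ?_) (by positivity) |>.2
      nlinarith [sq_nonneg (P s / 8 - 2 * P' s), mul_nonneg hP0 hP0', mul_nonneg hP0' hP0']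
  have hmin : Integrable (fun s => min (P s) (P' s)) (Measure.pi fun _ : Fin n => μ) :=
    hPi.inf hPi'
  have hPPi : Integrable (fun s => (P s + P' s) / 8) (Measure.pi fun _ : Fin n => μ) :=
    (hPi.add hPi').div_const 8
  have hmono := integral_mono (Integrable.fintype_prod fun _ => hwi)
    (hPPi.add (hmin.const_mul 2)) hpt
  have hsum : ∫ s, ((P s + P' s) / 8 + 2 * min (P s) (P' s)) ∂(Measure.pi fun _ => μ) =
      1 / 4 + 2 * ∫ s, min (P s) (P' s) ∂(Measure.pi fun _ => μ) := by
    rw [integral_add hPPi (hmin.const_mul 2), integral_div,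
      integral_add hPi hPi', integral_const_mul, hP, hP', hf, hf', hg.integral_prod_perturb,
      hg.integral_prod_perturb]
    norm_num
  have hfin : ∫ s : Fin n → X, ∏ r, w (s r) ∂(Measure.pi fun _ => μ) ≤
      1 / 4 + 2 * ∫ s, min (P s) (P' s) ∂(Measure.pi fun _ => μ) := by
    rw [← hsum]
    exact hmono
  linarith

theorem measurable_cellDist (hg : IsPerturbation μ n γ A g) {S : Type*} [MeasurableSpace S]
    {T : S → X → ℝ} (hT : Measurable fun z : S × X => T z.1 z.2) (i : Fin H) (b : Bool) :
    Measurable (cellDist μ A g T i b) := by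
  refine Measurable.lintegral_prod_right' (f := fun z : S × X =>
    ENNReal.ofReal |T z.1 z.2 - (1 + boolSign b * g i z.2)|) ?_
  have : Measurable fun z : S × X => g i z.2 := (hg.measurable i).comp measurable_snd
  exact ((hT.sub (measurable_const.add (this.const_mul _))).abs).ennreal_ofReal

theorem le_cellDist_add_cellDist (hg : IsPerturbation μ n γ A g) {S : Type*} [MeasurableSpace S]
    {T : S → X → ℝ} (hT : Measurable fun z : S × X => T z.1 z.2) (i : Fin H) (b : Bool) (s : S) :
    ENNReal.ofReal (2 * γ) ≤ cellDist μ A g T i b s + cellDist μ A g T i (!b) s := by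
  have hTs : Measurable (T s) := hT.comp measurable_prodMk_left
  have hgi := hg.measurable i
  unfold cellDist
  rw [← lintegral_add_left (by fun_prop)]
  have h1 : ENNReal.ofReal (2 * γ) = ∫⁻ x in A i, ENNReal.ofReal (2 * |g i x|) ∂μ := by
    rw [← hg.integral_abs i, ← integral_const_mul, ofReal_integral_eq_lintegral_ofReal
      ((hg.integrable i).abs.const_mul 2) (Filter.Eventually.of_forall fun x => by positivity)]
    symm
    refine setLIntegral_eq_of_support_subset fun x hx => ?_
    by_contra h
    exact hx (by simp [hg.eq_zero i x h])
  rw [h1]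
  refine lintegral_mono fun x => ?_
  rw [← ENNReal.ofReal_add (abs_nonneg _) (abs_nonneg _)]
  refine ENNReal.ofReal_le_ofReal ?_
  rw [boolSign_not]
  have h2 : 2 * |g i x| = |2 * (boolSign b * g i x)| := by
    rw [abs_mul, abs_mul, abs_boolSign, one_mul, abs_two]
  rw [h2, add_comm]
  refine le_trans (le_of_eq ?_) (abs_sub _ _)
  congr 1
  ring

/-- Assouad's lemma for the squared total variation loss. -/
theorem exists_le_lintegral_sq (hg : IsPerturbation μ n γ A g) {T : (Fin n → X) → X → ℝ}
    (hT : Measurable fun z : (Fin n → X) × X => T z.1 z.2) (hTi : ∀ s, Integrable (T s) μ) :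
    ∃ ω : Fin H → Bool, ENNReal.ofReal ((H * γ / 16) ^ 2) ≤
      ∫⁻ s, ENNReal.ofReal (((1 / 2) * ∫ x, |T s x - perturb g ω x| ∂μ) ^ 2)
        ∂(Measure.pi fun _ => μ.withDensity fun x => ENNReal.ofReal (perturb g ω x)) := by
  set ν : Measure (Fin n → X) := Measure.pi fun _ => μ with hν
  let P : (Fin H → Bool) → (Fin n → X) → ℝ := fun ω s => ∏ r, perturb g ω (s r)
  let F : (Fin H → Bool) → Fin H → ℝ≥0∞ := fun ω i =>
    ∫⁻ s, ENNReal.ofReal (P ω s) * cellDist μ A g T i (ω i) s ∂ν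
  have hPm : ∀ ω, Measurable (P ω) := fun ω => Finset.measurable_fun_prod _ fun r _ =>
    (hg.measurable_perturb ω).comp (measurable_pi_apply r)
  have hP0 : ∀ ω s, 0 ≤ P ω s := fun ω s => Finset.prod_nonneg fun r _ => hg.perturb_nonneg _ _
  rcases Nat.eq_zero_or_pos H with rfl | hH
  · exact ⟨fun _ => true, by simp⟩
  have hγ0 : 0 ≤ γ := by
    rw [← hg.integral_abs ⟨0, hH⟩]
    exact integral_nonneg fun _ => abs_nonneg _
  let flip : Fin H → (Fin H → Bool) → (Fin H → Bool) := fun i ω => Function.update ω i (!ω i)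
  have hflip : ∀ i, Function.Involutive (flip i) := fun i ω => by simp [flip]
  have hpair : ∀ ω i, ENNReal.ofReal (γ / 4) ≤ F ω i + F (flip i ω) i := by
    intro ω i
    have hmeas : ∀ ω b, Measurable fun s => ENNReal.ofReal (P ω s) * cellDist μ A g T i b s :=
      fun ω b => (hPm ω).ennreal_ofReal.mul (hg.measurable_cellDist hT i b)
    have hmin0 : ∀ s, 0 ≤ min (P ω s) (P (flip i ω) s) := fun s => le_min (hP0 _ _) (hP0 _ _)
    have hmini : Integrable (fun s => min (P ω s) (P (flip i ω) s)) ν :=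
      (hg.integrable_prod_perturb ω).inf (hg.integrable_prod_perturb (flip i ω))
    calc ENNReal.ofReal (γ / 4) = ENNReal.ofReal (1 / 8) * ENNReal.ofReal (2 * γ) := by
          rw [← ENNReal.ofReal_mul (by norm_num)]
          congr 1
          ring
      _ ≤ ENNReal.ofReal (∫ s, min (P ω s) (P (flip i ω) s) ∂ν) * ENNReal.ofReal (2 * γ) := by
          gcongr
          exact hg.le_integral_min ω i
      _ = ∫⁻ s, ENNReal.ofReal (min (P ω s) (P (flip i ω) s)) * ENNReal.ofReal (2 * γ) ∂ν := by
          rw [lintegral_mul_const _ ((hPm ω).min (hPm _)).ennreal_ofReal,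
            ofReal_integral_eq_lintegral_ofReal hmini (Filter.Eventually.of_forall hmin0)]
      _ ≤ ∫⁻ s, (ENNReal.ofReal (P ω s) * cellDist μ A g T i (ω i) s +
            ENNReal.ofReal (P (flip i ω) s) * cellDist μ A g T i (flip i ω i) s) ∂ν := by
          refine lintegral_mono fun s => ?_
          have hfi : flip i ω i = !ω i := by simp [flip]
          simp only [hfi]
          refine (mul_le_mul_right (hg.le_cellDist_add_cellDist hT i (ω i) s) _).trans ?_
          rw [mul_add]
          gcongr
          · exact min_le_left _ _
          · exact min_le_right _ _
      _ = _ := lintegral_add_left (hmeas _ _) _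
  have hsumF : ∀ i, ENNReal.ofReal (γ / 4) * Fintype.card (Fin H → Bool) ≤ 2 * ∑ ω, F ω i := by
    intro i
    have e1 : ∑ ω, F (flip i ω) i = ∑ ω, F ω i :=
      Equiv.sum_comp (hflip i).toPerm fun ω => F ω i
    calc _ = ∑ _ω : Fin H → Bool, ENNReal.ofReal (γ / 4) := by
          rw [Finset.sum_const, Finset.card_univ, nsmul_eq_mul, mul_comm]
      _ ≤ ∑ ω, (F ω i + F (flip i ω) i) := Finset.sum_le_sum fun ω _ => hpair ω i
      _ = 2 * ∑ ω, F ω i := by rw [Finset.sum_add_distrib, e1, two_mul]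
  obtain ⟨ω, hω⟩ : ∃ ω, ENNReal.ofReal (H * γ / 8) ≤ ∑ i, F ω i := by
    by_contra! hcon
    have h1 : ∑ ω, ∑ i, F ω i < ∑ _ω : Fin H → Bool, ENNReal.ofReal (H * γ / 8) :=
      ENNReal.sum_lt_sum_of_nonempty Finset.univ_nonempty fun ω _ => hcon ω
    have h2 : ∑ _i : Fin H, ENNReal.ofReal (γ / 4) * Fintype.card (Fin H → Bool) ≤
        2 * ∑ ω, ∑ i, F ω i := by
      rw [Finset.sum_comm, Finset.mul_sum]
      exact Finset.sum_le_sum fun i _ => hsumF i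
    have h3 : ∑ _i : Fin H, ENNReal.ofReal (γ / 4) * Fintype.card (Fin H → Bool) =
        2 * ∑ _ω : Fin H → Bool, ENNReal.ofReal (H * γ / 8) := by
      have e : ENNReal.ofReal (H * γ / 8) = H * ENNReal.ofReal (γ / 8) := by
        rw [mul_div_assoc, ENNReal.ofReal_mul (by positivity), ENNReal.ofReal_natCast]
      have e' : ENNReal.ofReal (γ / 4) = 2 * ENNReal.ofReal (γ / 8) := by
        rw [show γ / 4 = 2 * (γ / 8) by ring, ENNReal.ofReal_mul (by norm_num)]
        simp
      rw [Finset.sum_const, Finset.sum_const, Finset.card_univ, Finset.card_univ, nsmul_eq_mul,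
        nsmul_eq_mul, Fintype.card_fin, e, e']
      ring
    rw [h3] at h2
    have h4 := (ENNReal.mul_lt_mul_iff_right two_ne_zero ENNReal.ofNat_ne_top).2 h1
    exact absurd h2 (not_le.2 h4)
  refine ⟨ω, ?_⟩
  have := isProbabilityMeasure_withDensity_ofReal (hg.integrable_perturb ω)
    (Filter.Eventually.of_forall (hg.perturb_nonneg ω)) (hg.integral_perturb ω)
  set Q := Measure.pi fun _ : Fin n => μ.withDensity fun x => ENNReal.ofReal (perturb g ω x)
    with hQ
  set τ : ℝ := H * γ / 16 with hτ
  have hτ0 : 0 ≤ τ := by positivity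
  set t : (Fin n → X) → ℝ := fun s => (1 / 2) * ∫ x, |T s x - perturb g ω x| ∂μ with ht
  have ht0 : ∀ s, 0 ≤ t s := fun s =>
    mul_nonneg (by norm_num) (integral_nonneg fun _ => abs_nonneg _)
  have hmean : ENNReal.ofReal (2 * τ) ≤ ∫⁻ s, ENNReal.ofReal (2 * t s) ∂Q := by
    have h2t : ∀ s, ENNReal.ofReal (2 * t s) =
        ∫⁻ x, ENNReal.ofReal |T s x - perturb g ω x| ∂μ := by
      intro s
      have hi : Integrable (fun x => |T s x - perturb g ω x|) μ :=
        ((hTi s).sub (hg.integrable_perturb ω)).abs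
      rw [← ofReal_integral_eq_lintegral_ofReal hi
        (Filter.Eventually.of_forall fun _ => abs_nonneg _), ht]
      congr 1
      ring
    have hDm : ∀ i, Measurable (cellDist μ A g T i (ω i)) := fun i =>
      hg.measurable_cellDist hT i (ω i)
    calc ENNReal.ofReal (2 * τ) = ENNReal.ofReal (H * γ / 8) := by rw [hτ]; congr 1; ring
      _ ≤ ∑ i, F ω i := hω
      _ = ∑ i, ∫⁻ s, cellDist μ A g T i (ω i) s ∂Q := by
          refine Finset.sum_congr rfl fun i _ => ?_
          rw [hQ, pi_withDensity_ofReal (hg.integrable_perturb ω) (hg.perturb_nonneg ω),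
            lintegral_withDensity_eq_lintegral_mul _ (hPm ω).ennreal_ofReal (hDm i)]
          rfl
      _ = ∫⁻ s, ∑ i, cellDist μ A g T i (ω i) s ∂Q :=
          (lintegral_finsetSum _ fun i _ => hDm i).symm
      _ ≤ ∫⁻ s, ENNReal.ofReal (2 * t s) ∂Q := by
          refine lintegral_mono fun s => ?_
          rw [h2t]
          exact hg.sum_cellDist_le T ω s
  have hsq : ∀ s, ENNReal.ofReal τ * ENNReal.ofReal (2 * t s) ≤
      ENNReal.ofReal (t s ^ 2) + ENNReal.ofReal (τ ^ 2) := by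
    intro s
    rw [← ENNReal.ofReal_mul hτ0, ← ENNReal.ofReal_add (by positivity) (by positivity)]
    exact ENNReal.ofReal_le_ofReal (by nlinarith [sq_nonneg (t s - τ)])
  have hfin : ENNReal.ofReal (τ ^ 2) + ENNReal.ofReal (τ ^ 2) ≤
      ∫⁻ s, ENNReal.ofReal (t s ^ 2) ∂Q + ENNReal.ofReal (τ ^ 2) :=
    calc ENNReal.ofReal (τ ^ 2) + ENNReal.ofReal (τ ^ 2)
        = ENNReal.ofReal τ * ENNReal.ofReal (2 * τ) := by
          rw [← ENNReal.ofReal_mul hτ0, ← ENNReal.ofReal_add (by positivity) (by positivity)]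
          congr 1
          ring
      _ ≤ ENNReal.ofReal τ * ∫⁻ s, ENNReal.ofReal (2 * t s) ∂Q := by gcongr
      _ = ∫⁻ s, ENNReal.ofReal τ * ENNReal.ofReal (2 * t s) ∂Q :=
          (lintegral_const_mul' _ _ ENNReal.ofReal_ne_top).symm
      _ ≤ ∫⁻ s, (ENNReal.ofReal (t s ^ 2) + ENNReal.ofReal (τ ^ 2)) ∂Q := lintegral_mono hsq
      _ = _ := by rw [lintegral_add_right _ measurable_const]; simp
  exact (ENNReal.add_le_add_iff_right ENNReal.ofReal_ne_top).1 hfin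

end IsPerturbation

end Assouad

theorem integral_volCube_comp_eval {d : ℕ} (j : Fin d) {φ : ℝ → ℝ} (hφ : Continuous φ) :
    ∫ x, φ (x j) ∂volCube d = ∫ y in Set.Icc (0 : ℝ) 1, φ y := by
  have h := (measurePreserving_eval (fun _ : Fin d => volI) j).map_eq
  change _ = ∫ y, φ y ∂volI
  rw [← h, integral_map (measurable_pi_apply j).aemeasurable hφ.aestronglyMeasurable]
  rfl

/-- A mixture whose density depends on one coordinate only. -/
theorem comp_eval_mem_mixtureClass {L q : ℝ} {m d : ℕ} (hL : 0 ≤ L) (hm : 1 ≤ m) {f : ℝ → ℝ}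
    (hf : f ∈ HolderClass L q) (j : Fin d) :
    (fun x : Fin d → ℝ => f (x j)) ∈ MixtureClass L q m d := by
  classical
  have hm0 : (m : ℝ) ≠ 0 := by positivity
  refine ⟨fun _ => 1 / m, fun _ j' => if j' = j then f else fun _ => 1, fun _ => by positivity,
    by simp [hm0], fun _ j' => ?_, ?_⟩
  · dsimp only
    split_ifs
    exacts [hf, one_mem_holderClass hL]
  · ext x
    have : ∏ j', (if j' = j then f else fun _ => 1) (x j') = f (x j) := by
      rw [Fintype.prod_eq_single j]
      · simp
      · intro j' hj'
        simp [hj']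
    simp only [this, Finset.sum_const, Finset.card_univ, Fintype.card_fin, nsmul_eq_mul]
    field_simp

namespace IsHolderBump

variable {q M : ℝ} {ψ : ℝ → ℝ} {H n d : ℕ}

theorem integral_sq_le_one (hψ : IsHolderBump q M ψ) : ∫ x, ψ x ^ 2 ≤ 1 := by
  rw [← setIntegral_eq_integral_of_forall_compl_eq_zero (s := Set.Icc (0 : ℝ) 1)]
  · calc ∫ x in Set.Icc (0 : ℝ) 1, ψ x ^ 2 ≤ ∫ _ in Set.Icc (0 : ℝ) 1, (1 : ℝ) := by
          refine integral_mono (hψ.continuous.pow 2).integrableOn_Icc (integrable_const _)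
            fun x => ?_
          exact (sq_le_one_iff_abs_le_one _).2 (hψ.abs_le_one x)
      _ = 1 := by simp
  · intro x hx
    rw [hψ.eq_zero x fun h => hx (Set.Ioo_subset_Icc_self h)]
    norm_num

theorem isPerturbation (hψ : IsHolderBump q M ψ) (hH : 0 < H) {a : ℝ} (ha0 : 0 ≤ a)
    (ha1 : a ≤ 1 / 2) (han : n * (a ^ 2 / H) ≤ 1 / 2) (j : Fin d) :
    IsPerturbation (volCube d) n (a / H * ∫ x, |ψ x|)
      (fun (i : Fin H) => (fun x : Fin d → ℝ => x j) ⁻¹' Set.Ioo (i / H : ℝ) ((i + 1) / H))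
      (fun i x => a * ψ (H * x j - i)) := by
  have hH0 : (0 : ℝ) < H := by exact_mod_cast hH
  have hc := hψ.continuous
  refine ⟨fun i => ?_, fun i => measurable_pi_apply j measurableSet_Ioo, fun i k hik => ?_,
    fun i x hx => ?_, fun i x => ?_, fun i => ?_, fun i => ?_, fun i => ?_⟩
  · exact (by fun_prop : Continuous fun x : Fin d → ℝ => a * ψ (H * x j - i)).measurable
  · refine Set.disjoint_left.2 fun x hi hk => hik ?_
    have h1 := hi.1.trans hk.2
    have h2 := hk.1.trans hi.2
    rw [div_lt_div_iff_of_pos_right hH0] at h1 h2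
    have h3 : (i : ℕ) < k + 1 := by exact_mod_cast h1
    have h4 : (k : ℕ) < i + 1 := by exact_mod_cast h2
    exact Fin.ext (by omega)
  · have : ψ (H * x j - i) = 0 := by
      by_contra h
      exact hx (hψ.mem_Ioo_of_ne_zero hH h)
    rw [this, mul_zero]
  · rw [abs_mul, abs_of_nonneg ha0]
    exact (mul_le_of_le_one_right ha0 (hψ.abs_le_one _)).trans ha1
  · rw [integral_volCube_comp_eval j (φ := fun y => a * ψ (H * y - i)) (by fun_prop),
      hψ.setIntegral_comp hH i (φ := fun y => a * y) (mul_zero a), integral_const_mul,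
      hψ.integral_eq_zero, mul_zero, mul_zero]
  · rw [integral_volCube_comp_eval j (φ := fun y => |a * ψ (H * y - i)|) (by fun_prop),
      hψ.setIntegral_comp hH i (φ := fun y => |a * y|) (by simp)]
    simp only [abs_mul, abs_of_nonneg ha0]
    rw [integral_const_mul]
    ring
  · rw [integral_volCube_comp_eval j (φ := fun y => (a * ψ (H * y - i)) ^ 2) (by fun_prop),
      hψ.setIntegral_comp hH i (φ := fun y => (a * y) ^ 2) (by simp)]
    simp only [mul_pow]
    rw [integral_const_mul]
    refine le_trans ?_ han
    calc n * ((H : ℝ)⁻¹ * (a ^ 2 * ∫ x, ψ x ^ 2)) ≤ n * ((H : ℝ)⁻¹ * (a ^ 2 * 1)) := by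
          gcongr
          exact hψ.integral_sq_le_one
      _ = n * (a ^ 2 / H) := by ring

theorem le_minimaxRisk (hψ : IsHolderBump q M ψ) (hH : 0 < H) {L a : ℝ} {m : ℕ} (hL : 0 ≤ L)
    (hm : 1 ≤ m) (hd : 1 ≤ d) (ha0 : 0 ≤ a) (ha1 : a ≤ 1 / 2) (haL : 2 * (a * H ^ q) * M ≤ L)
    (han : n * (a ^ 2 / H) ≤ 1 / 2) :
    ENNReal.ofReal ((a * (∫ x, |ψ x|) / 16) ^ 2) ≤
      minimaxRisk L q m d n (fun p₁ p₂ => tvDist p₁ p₂) := by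
  have hH0 : (0 : ℝ) < H := by exact_mod_cast hH
  refine le_iInf fun est => le_iInf fun hest => le_iInf fun hdens => ?_
  have hg_int : ∀ s, Integrable (est s) (volCube d) := by
    intro s
    have h := (hdens s).2
    rw [restrict_unitCube] at h
    by_contra hcon
    rw [integral_undef hcon] at h
    exact zero_ne_one h
  have hpert := hψ.isPerturbation hH ha0 ha1 han ⟨0, hd⟩
  obtain ⟨ω, hω⟩ := hpert.exists_le_lintegral_sq hest hg_int
  have hmem := comp_eval_mem_mixtureClass (m := m) hL hm
    (hψ.perturb_mem_holderClass hH ha0 (by linarith) haL (ε := fun i => boolSign (ω i))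
      fun i => (abs_boolSign _).le) (⟨0, hd⟩ : Fin d)
  refine le_iSup₂_of_le _ hmem ?_
  simp only [tvDist_eq, sampleMeasure_eq]
  refine le_trans (le_of_eq ?_) hω
  congr 2
  field_simp

end IsHolderBump

theorem exists_le_minimaxRisk {q L : ℝ} (hq : 0 < q) (hL : 0 < L) :
    ∃ c : ℝ, 0 < c ∧ ∀ m d n : ℕ, 1 ≤ m → 1 ≤ d → 1 ≤ n →
      ENNReal.ofReal (c * (n : ℝ) ^ (-(2 * q / (2 * q + 1)))) ≤
        minimaxRisk L q m d n (fun p₁ p₂ => tvDist p₁ p₂) := by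
  obtain ⟨M, ψ, hψ⟩ := exists_isHolderBump hq
  have hM := hψ.const_nonneg
  have hI := hψ.integral_abs_pos
  set κ : ℝ := min (1 / 2) (L / (2 * (M + 1))) with hκ
  have hκ0 : 0 < κ := lt_min (by norm_num) (by positivity)
  have hκ1 : κ ≤ 1 / 2 := min_le_left _ _
  have hκL : 2 * κ * M ≤ L := by
    have : κ * (2 * (M + 1)) ≤ L := by
      rw [← le_div_iff₀ (by positivity)]
      exact min_le_right _ _
    nlinarith
  refine ⟨(κ * 2 ^ (-q) * (∫ x, |ψ x|) / 16) ^ 2, by positivity, fun m d n hm hd hn => ?_⟩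
  have hn1 : (1 : ℝ) ≤ n := by exact_mod_cast hn
  have hn0 : (0 : ℝ) < n := by linarith
  have hq1 : 0 < 2 * q + 1 := by linarith
  set e : ℝ := 1 / (2 * q + 1) with he
  set H := ⌈(n : ℝ) ^ e⌉₊ with hH
  have hne : 1 ≤ (n : ℝ) ^ e := Real.one_le_rpow hn1 (by positivity)
  have hHle : (n : ℝ) ^ e ≤ H := Nat.le_ceil _
  have hHge : (H : ℝ) ≤ 2 * (n : ℝ) ^ e := by
    have := Nat.ceil_lt_add_one (a := (n : ℝ) ^ e) (by positivity)
    linarith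
  have hH1 : (1 : ℝ) ≤ H := hne.trans hHle
  have hH0 : (0 : ℝ) < H := by linarith
  have hHpos : 0 < H := by exact_mod_cast hH0
  have hHn : (n : ℝ) ≤ (H : ℝ) ^ (2 * q + 1) := by
    calc (n : ℝ) = ((n : ℝ) ^ e) ^ (2 * q + 1) := by
          rw [← Real.rpow_mul hn0.le, he, one_div_mul_cancel hq1.ne', Real.rpow_one]
      _ ≤ _ := by gcongr
  have hHq1 : (H : ℝ) ^ (-q) ≤ 1 := Real.rpow_le_one_of_one_le_of_nonpos hH1 (by linarith)
  have hHq0 : 0 < (H : ℝ) ^ (-q) := by positivity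
  have hmul : (H : ℝ) ^ (-q) * (H : ℝ) ^ q = 1 := by
    rw [← Real.rpow_add hH0, neg_add_cancel, Real.rpow_zero]
  refine le_trans (ENNReal.ofReal_le_ofReal ?_) (hψ.le_minimaxRisk hHpos (a := κ * (H : ℝ) ^ (-q))
    hL.le hm hd (by positivity) (by nlinarith) (by rw [mul_assoc κ, hmul, mul_one]; exact hκL) ?_)
  · have h1 : 2 ^ (-q) * (n : ℝ) ^ (-(q * e)) ≤ (H : ℝ) ^ (-q) := by
      calc 2 ^ (-q) * (n : ℝ) ^ (-(q * e)) = (2 * (n : ℝ) ^ e) ^ (-q) := by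
            rw [Real.mul_rpow (by norm_num) (by positivity), ← Real.rpow_mul hn0.le]
            congr 2
            ring
        _ ≤ _ := Real.rpow_le_rpow_of_nonpos hH0 hHge (by linarith)
    have h2 : (n : ℝ) ^ (-(2 * q / (2 * q + 1))) = ((n : ℝ) ^ (-(q * e))) ^ 2 := by
      rw [← Real.rpow_natCast, ← Real.rpow_mul hn0.le]
      congr 1
      rw [he]
      push_cast
      ring
    rw [h2, ← mul_pow]
    refine pow_le_pow_left₀ (by positivity) ?_ 2
    calc _ = κ * (2 ^ (-q) * (n : ℝ) ^ (-(q * e))) * (∫ x, |ψ x|) / 16 := by ring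
      _ ≤ _ := by gcongr
  · have h3 : (H : ℝ) ^ (2 * q + 1) * ((H : ℝ) ^ (-q)) ^ 2 = H := by
      rw [← Real.rpow_natCast, ← Real.rpow_mul hH0.le, ← Real.rpow_add hH0]
      push_cast
      rw [show 2 * q + 1 + -q * 2 = 1 by ring, Real.rpow_one]
    calc n * ((κ * (H : ℝ) ^ (-q)) ^ 2 / H)
        ≤ (H : ℝ) ^ (2 * q + 1) * ((κ * (H : ℝ) ^ (-q)) ^ 2 / H) := by gcongr
      _ = κ ^ 2 * ((H : ℝ) ^ (2 * q + 1) * ((H : ℝ) ^ (-q)) ^ 2) / H := by ring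
      _ = κ ^ 2 := by rw [h3]; field_simp
      _ ≤ 1 / 2 := by nlinarith

/-- **Minimax rate under squared total variation loss (Theorem 3.8, part 2).** For all
`n ≥ 2`, `c (n log n)^{-2q/(2q+1)} ≤ R*_TV ≤ C m^{2q/(2q+1)} d^{(2q+2)/(2q+1)} n^{-2q/(2q+1)}`. -/
theorem minimax_tv_rate (q L : ℝ) (hq : 0 < q) (hL : 0 < L) :
    ∃ c C : ℝ, 0 < c ∧ 0 < C ∧
      ∀ m d n : ℕ, 1 ≤ m → 1 ≤ d → 2 ≤ n →
        ENNReal.ofReal (c * ((n : ℝ) * Real.log n) ^ (-(2 * q / (2 * q + 1)))) ≤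
            minimaxRisk L q m d n (fun p₁ p₂ => tvDist p₁ p₂) ∧
          minimaxRisk L q m d n (fun p₁ p₂ => tvDist p₁ p₂) ≤
            ENNReal.ofReal (C * (m : ℝ) ^ (2 * q / (2 * q + 1)) *
              (d : ℝ) ^ ((2 * q + 2) / (2 * q + 1)) * (n : ℝ) ^ (-(2 * q / (2 * q + 1)))) := by
  obtain ⟨c, hc, hlower⟩ := exists_le_minimaxRisk hq hL
  obtain ⟨C, hC, hupper⟩ := exists_minimaxRisk_le hq hL.le
  have hlog2 : 0 < Real.log 2 := Real.log_pos one_lt_two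
  set α := 2 * q / (2 * q + 1) with hα
  have hα0 : 0 < α := by positivity
  refine ⟨c * Real.log 2 ^ α, C, by positivity, hC, fun m d n hm hd hn =>
    ⟨le_trans (ENNReal.ofReal_le_ofReal ?_) (hlower m d n hm hd (by omega)),
      hupper m d n hm hd (by omega)⟩⟩
  have hn2 : (2 : ℝ) ≤ n := by exact_mod_cast hn
  have hlog : Real.log 2 ≤ Real.log n := Real.log_le_log two_pos hn2
  have hlogn : 0 < Real.log n := hlog2.trans_le hlog
  rw [Real.mul_rpow (by positivity) hlogn.le, mul_assoc c]
  gcongr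
  have h1 : Real.log n ^ (-α) ≤ Real.log 2 ^ (-α) :=
    Real.rpow_le_rpow_of_nonpos hlog2 hlog (by linarith)
  have h2 : Real.log 2 ^ α * Real.log 2 ^ (-α) = 1 := by
    rw [← Real.rpow_add hlog2, add_neg_cancel, Real.rpow_zero]
  calc Real.log 2 ^ α * ((n : ℝ) ^ (-α) * Real.log n ^ (-α))
      ≤ Real.log 2 ^ α * ((n : ℝ) ^ (-α) * Real.log 2 ^ (-α)) := by gcongr
    _ = (Real.log 2 ^ α * Real.log 2 ^ (-α)) * (n : ℝ) ^ (-α) := by ring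
    _ = (n : ℝ) ^ (-α) := by rw [h2, one_mul]
end

section
/- Suppose A, B ∈ ℝ^{m×m} are real symmetric positive semidefinite matrices, and let k₁, k₂ ≥ 1 be integers with k₁ + k₂ ≤ m + 1. Then the Kruskal eigenvalues satisfy λ^{Kru}_{k₁+k₂−1}(A∘B) ≥ λ^{Kru}_{k₁}(A) · λ^{Kru}_{k₂}(B) / (k₁ + k₂), where A∘B is the Hadamard (entrywise) product. -/
open scoped Matrix

/-- The smallest eigenvalue of a real symmetric matrix, characterized variationally as the
largest `c` with `c‖x‖² ≤ xᵀMx` for all `x`. -/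
noncomputable def lambdaMin {ι : Type*} [Fintype ι] (M : Matrix ι ι ℝ) : ℝ :=
  sSup {c : ℝ | ∀ x : ι → ℝ, c * (∑ i, x i ^ 2) ≤ x ⬝ᵥ M.mulVec x}

/-- The `k`-th Kruskal eigenvalue of a Gram matrix `A`: the minimum over all principal
`k × k` submatrices of the smallest eigenvalue. -/
noncomputable def kruskalEigenvalue {m : ℕ} (A : Matrix (Fin m) (Fin m) ℝ) (k : ℕ) : ℝ :=
  sInf {r : ℝ | ∃ S : Finset (Fin m), S.card = k ∧
    r = lambdaMin (A.submatrix (fun i : S => (i : Fin m)) (fun j : S => (j : Fin m)))}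

open Matrix

section LambdaMin

variable {ι : Type*} [Fintype ι]

lemma le_lambdaMin [Nonempty ι] (M : Matrix ι ι ℝ) {c : ℝ}
    (h : ∀ x : ι → ℝ, c * (∑ i, x i ^ 2) ≤ x ⬝ᵥ M.mulVec x) : c ≤ lambdaMin M := by
  refine le_csSup ⟨(∑ i, ∑ j, M i j) / Fintype.card ι, fun d hd => ?_⟩ h
  rw [le_div_iff₀ (by exact_mod_cast Fintype.card_pos)]
  simpa [dotProduct, mulVec] using hd fun _ => 1

lemma Matrix.PosSemidef.zero_mul_sum_sq_le {M : Matrix ι ι ℝ} (hM : M.PosSemidef) (x : ι → ℝ) :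
    0 * (∑ i, x i ^ 2) ≤ x ⬝ᵥ M.mulVec x := by
  simpa using hM.dotProduct_mulVec_nonneg x

lemma Matrix.PosSemidef.lambdaMin_mul_le {M : Matrix ι ι ℝ} (hM : M.PosSemidef) (x : ι → ℝ) :
    lambdaMin M * (∑ i, x i ^ 2) ≤ x ⬝ᵥ M.mulVec x := by
  rcases (Finset.sum_nonneg fun i _ => sq_nonneg (x i)).eq_or_lt with h0 | hpos
  · rw [← h0, mul_zero]
    simpa using hM.zero_mul_sum_sq_le x
  · rw [← le_div_iff₀ hpos]
    refine csSup_le ⟨0, hM.zero_mul_sum_sq_le⟩ fun c hc => ?_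
    rw [le_div_iff₀ hpos]
    exact hc x

lemma Matrix.PosSemidef.lambdaMin_nonneg {M : Matrix ι ι ℝ} (hM : M.PosSemidef) :
    0 ≤ lambdaMin M :=
  Real.sSup_nonneg' ⟨0, hM.zero_mul_sum_sq_le, le_rfl⟩

end LambdaMin

section KruskalEigenvalue

variable {m : ℕ} {A : Matrix (Fin m) (Fin m) ℝ}

lemma Matrix.PosSemidef.kruskalEigenvalue_nonneg (hA : A.PosSemidef) (k : ℕ) :
    0 ≤ kruskalEigenvalue A k := by
  refine Real.sInf_nonneg ?_
  rintro _ ⟨S, -, rfl⟩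
  exact (hA.submatrix _).lambdaMin_nonneg

lemma sum_coe_of_eq_zero {S : Finset (Fin m)} {f : Fin m → ℝ} (hf : ∀ i ∉ S, f i = 0) :
    ∑ i : S, f i = ∑ i, f i := by
  rw [Finset.sum_coe_sort S f]
  exact Finset.sum_subset (Finset.subset_univ S) fun i _ hi => hf i hi

lemma dotProduct_submatrix_mulVec_of_eq_zero (A : Matrix (Fin m) (Fin m) ℝ)
    {S : Finset (Fin m)} {x : Fin m → ℝ} (hx : ∀ i ∉ S, x i = 0) :
    (fun i : S => x i) ⬝ᵥ (A.submatrix (fun i : S => (i : Fin m)) (fun j : S => (j : Fin m))).mulVec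
      (fun i : S => x i) = x ⬝ᵥ A.mulVec x := by
  simp only [dotProduct, mulVec, submatrix_apply]
  rw [← sum_coe_of_eq_zero (S := S) fun i hi => by simp [hx i hi]]
  refine Finset.sum_congr rfl fun i _ => ?_
  rw [← sum_coe_of_eq_zero (S := S) fun j hj => by simp [hx j hj]]

lemma Matrix.PosSemidef.kruskalEigenvalue_mul_le (hA : A.PosSemidef) {S : Finset (Fin m)}
    {x : Fin m → ℝ} (hx : ∀ i ∉ S, x i = 0) :
    kruskalEigenvalue A S.card * (∑ i, x i ^ 2) ≤ x ⬝ᵥ A.mulVec x := by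
  have hle : kruskalEigenvalue A S.card ≤
      lambdaMin (A.submatrix (fun i : S => (i : Fin m)) (fun j : S => (j : Fin m))) := by
    refine csInf_le ⟨0, ?_⟩ ⟨S, rfl, rfl⟩
    rintro _ ⟨T, -, rfl⟩
    exact (hA.submatrix _).lambdaMin_nonneg
  refine (mul_le_mul_of_nonneg_right hle (Finset.sum_nonneg fun i _ => sq_nonneg (x i))).trans ?_
  rw [← dotProduct_submatrix_mulVec_of_eq_zero A hx,
    ← sum_coe_of_eq_zero (S := S) (f := fun i => x i ^ 2) fun i hi => by simp [hx i hi]]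
  exact (hA.submatrix _).lambdaMin_mul_le _

lemma le_kruskalEigenvalue {k : ℕ} (hk : 1 ≤ k) (hkm : k ≤ m) {c : ℝ}
    (h : ∀ S : Finset (Fin m), S.card = k → ∀ x : Fin m → ℝ, (∀ i ∉ S, x i = 0) →
      c * (∑ i, x i ^ 2) ≤ x ⬝ᵥ A.mulVec x) : c ≤ kruskalEigenvalue A k := by
  refine le_csInf ?_ ?_
  · obtain ⟨S, -, hS⟩ := Finset.exists_subset_card_eq (s := (Finset.univ : Finset (Fin m)))
      (by simpa using hkm)
    exact ⟨_, S, hS, rfl⟩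
  · rintro _ ⟨S, hS, rfl⟩
    have : Nonempty S := (Finset.card_pos.mp (by omega)).to_subtype
    refine le_lambdaMin _ fun x => ?_
    let y : Fin m → ℝ := fun i => if hi : i ∈ S then x ⟨i, hi⟩ else 0
    have hy : ∀ i ∉ S, y i = 0 := fun i hi => by simp [y, hi]
    have hyx : (fun i : S => y i) = x := by
      ext i
      simp [y]
    have := h S hS y hy
    rw [← dotProduct_submatrix_mulVec_of_eq_zero A hy, hyx,
      ← sum_coe_of_eq_zero (S := S) (f := fun i => y i ^ 2) fun i hi => by simp [hy i hi]] at this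
    simpa only [← hyx] using this

end KruskalEigenvalue

/-- A positive semidefinite real matrix is the Gram matrix of some vectors. -/
lemma Matrix.PosSemidef.exists_eq_gram {m : ℕ} {A : Matrix (Fin m) (Fin m) ℝ}
    (hA : A.PosSemidef) : ∃ v : Fin m → EuclideanSpace ℝ (Fin m), A = gram ℝ v := by
  open scoped MatrixOrder in
  obtain ⟨M, rfl⟩ := CStarAlgebra.nonneg_iff_eq_star_mul_self.mp hA.nonneg
  refine ⟨fun i => WithLp.toLp 2 fun l => M l i, ?_⟩
  ext i j
  simp [gram_apply, mul_apply, PiLp.inner_apply, mul_comm]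

/-- Projecting a Gram representation off the vectors indexed by `R` gives a matrix below `A` in
the Loewner order, vanishing on `R` and with diagonal entries bounded below outside `R`. -/
lemma Matrix.PosSemidef.exists_gram_eq_zero_on {m : ℕ} {A : Matrix (Fin m) (Fin m) ℝ}
    (hA : A.PosSemidef) (R : Finset (Fin m)) :
    ∃ w : Fin m → EuclideanSpace ℝ (Fin m), (A - gram ℝ w).PosSemidef ∧ (∀ i ∈ R, w i = 0) ∧
      ∀ i ∉ R, kruskalEigenvalue A (R.card + 1) ≤ ‖w i‖ ^ 2 := by
  obtain ⟨v, hv⟩ := hA.exists_eq_gram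
  let K := Submodule.span ℝ (v '' R)
  refine ⟨fun i => v i - K.starProjection (v i), ?_, fun i hi => ?_, fun i hi => ?_⟩
  · suffices h : A - gram ℝ (fun i => v i - K.starProjection (v i)) =
        gram ℝ fun i => K.starProjection (v i) from h ▸ posSemidef_gram ℝ _
    ext i j
    have h₁ := K.starProjection_inner_eq_zero (v i) _ (K.starProjection_apply_mem (v j))
    have h₂ := K.starProjection_inner_eq_zero (v j) _ (K.starProjection_apply_mem (v i))
    rw [real_inner_comm] at h₂
    simp only [inner_sub_left, inner_sub_right, hv, sub_apply, gram_apply] at h₁ h₂ ⊢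
    linarith
  · exact sub_eq_zero.mpr (K.starProjection_eq_self_iff.mpr
      (Submodule.subset_span ⟨i, hi, rfl⟩)).symm
  · obtain ⟨c, hc⟩ := Submodule.mem_span_image_finset_iff_exists_fun' ℝ |>.mp
      (K.starProjection_apply_mem (v i))
    let x : Fin m → ℝ := fun j => if j = i then 1 else if j ∈ R then - c j else 0
    have hx : ∀ j ∉ insert i R, x j = 0 := fun j hj => by
      simp only [Finset.mem_insert, not_or] at hj
      simp [x, hj]
    have hsum : ∑ j, x j • v j = v i - K.starProjection (v i) := by
      rw [← Finset.sum_subset (Finset.subset_univ (insert i R)) fun j _ hj => by simp [hx j hj],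
        Finset.sum_insert hi, ← hc, sub_eq_add_neg, ← Finset.sum_neg_distrib]
      congr 1
      · simp [x]
      · refine Finset.sum_congr rfl fun j hj => ?_
        have : j ≠ i := fun h => hi (h ▸ hj)
        simp [x, hj, this]
    have hle := hA.kruskalEigenvalue_mul_le hx
    rw [Finset.card_insert_of_notMem hi] at hle
    have hquad : x ⬝ᵥ A.mulVec x = ‖v i - K.starProjection (v i)‖ ^ 2 := by
      have := star_dotProduct_gram_mulVec (𝕜 := ℝ) v x x
      rw [hsum, real_inner_self_eq_norm_sq] at this
      simpa [hv] using this
    have hone : 1 ≤ ∑ j, x j ^ 2 := by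
      have := Finset.single_le_sum (fun j _ => sq_nonneg (x j)) (Finset.mem_univ i)
      simpa [x] using this
    rw [hquad] at hle
    exact (le_mul_of_one_le_right (hA.kruskalEigenvalue_nonneg _) hone).trans hle

/-- A Schur product bound: the quadratic form of `gram ℝ w ⊙ B` at `x` when the vectors
`x i • w i` are supported on `T`. -/
lemma Matrix.PosSemidef.kruskalEigenvalue_mul_le_gram_hadamard {m : ℕ}
    {B : Matrix (Fin m) (Fin m) ℝ} (hB : B.PosSemidef) {T : Finset (Fin m)}
    {w : Fin m → EuclideanSpace ℝ (Fin m)} {x : Fin m → ℝ} (hx : ∀ i ∉ T, x i • w i = 0) :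
    kruskalEigenvalue B T.card * (∑ i, x i ^ 2 * ‖w i‖ ^ 2) ≤
      x ⬝ᵥ (Matrix.hadamard (gram ℝ w) B).mulVec x := by
  have hle : ∀ l, kruskalEigenvalue B T.card * (∑ i, (x i * w i l) ^ 2) ≤
      (fun i => x i * w i l) ⬝ᵥ B.mulVec fun i => x i * w i l := fun l =>
    hB.kruskalEigenvalue_mul_le fun i hi => by simpa using congrArg (fun u => u l) (hx i hi)
  have hsum := Finset.sum_le_sum fun l (_ : l ∈ Finset.univ) => hle l
  have hleft : ∑ l, kruskalEigenvalue B T.card * (∑ i, (x i * w i l) ^ 2) =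
      kruskalEigenvalue B T.card * (∑ i, x i ^ 2 * ‖w i‖ ^ 2) := by
    rw [← Finset.mul_sum, Finset.sum_comm]
    simp [EuclideanSpace.norm_sq_eq, mul_pow, Finset.mul_sum]
  have hright : ∑ l, ((fun i => x i * w i l) ⬝ᵥ B.mulVec fun i => x i * w i l) =
      x ⬝ᵥ (Matrix.hadamard (gram ℝ w) B).mulVec x := by
    simp only [dotProduct, mulVec, hadamard_apply, gram_apply, PiLp.inner_apply, Finset.mul_sum,
      Finset.sum_mul]
    rw [Finset.sum_comm]
    refine Finset.sum_congr rfl fun i _ => ?_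
    rw [Finset.sum_comm]
    refine Finset.sum_congr rfl fun j _ => Finset.sum_congr rfl fun l _ => ?_
    simp only [RCLike.inner_apply, conj_trivial]
    ring
  rwa [hleft, hright] at hsum

/-- **Kruskal eigenvalues of a Hadamard product (Lemma B.3).** For positive semidefinite
`A, B ∈ ℝ^{m×m}` and `k₁ + k₂ ≤ m + 1`,
`λ^Kru_{k₁+k₂−1}(A∘B) ≥ λ^Kru_{k₁}(A) λ^Kru_{k₂}(B) / (k₁ + k₂)`. -/
theorem kruskalEigenvalue_hadamard {m : ℕ} (A B : Matrix (Fin m) (Fin m) ℝ)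
    (hA : A.PosSemidef) (hB : B.PosSemidef)
    (k₁ k₂ : ℕ) (hk₁ : 1 ≤ k₁) (hk₂ : 1 ≤ k₂) (hk : k₁ + k₂ ≤ m + 1) :
    kruskalEigenvalue A k₁ * kruskalEigenvalue B k₂ / ((k₁ : ℝ) + k₂) ≤
      kruskalEigenvalue (Matrix.hadamard A B) (k₁ + k₂ - 1) := by
  refine le_kruskalEigenvalue (by omega) (by omega) fun S hS x hx => ?_
  have ha := hA.kruskalEigenvalue_nonneg k₁
  have hb := hB.kruskalEigenvalue_nonneg k₂
  obtain ⟨p, hpS, hp⟩ := S.exists_max_image (fun i => x i ^ 2) (Finset.card_pos.mp (by omega))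
  obtain ⟨R, hRS, hR⟩ := Finset.exists_subset_card_eq (s := S.erase p) (n := k₁ - 1)
    (by rw [Finset.card_erase_of_mem hpS]; omega)
  have hpR : p ∉ R := fun h => Finset.notMem_erase p S (hRS h)
  have hT : (S \ R).card = k₂ := by
    rw [Finset.card_sdiff_of_subset (hRS.trans (S.erase_subset p))]
    omega
  obtain ⟨w, hAw, hwR, hwp⟩ := hA.exists_gram_eq_zero_on R
  have hap := hwp p hpR
  rw [show R.card + 1 = k₁ by omega] at hap
  have hxw : ∀ i ∉ S \ R, x i • w i = 0 := fun i hi => by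
    by_cases hiS : i ∈ S
    · rw [hwR i (by simpa [hiS] using hi), smul_zero]
    · rw [hx i hiS, zero_smul]
  have hCB := hB.kruskalEigenvalue_mul_le_gram_hadamard hxw
  rw [hT] at hCB
  have hAB : x ⬝ᵥ (Matrix.hadamard (gram ℝ w) B).mulVec x ≤ x ⬝ᵥ (Matrix.hadamard A B).mulVec x := by
    have := (hAw.hadamard hB).dotProduct_mulVec_nonneg x
    have hsplit : Matrix.hadamard A B = Matrix.hadamard (A - gram ℝ w) B + Matrix.hadamard (gram ℝ w) B := by
      rw [← add_hadamard, sub_add_cancel]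
    rw [hsplit, add_mulVec, dotProduct_add]
    simpa using this
  have hterm : x p ^ 2 * ‖w p‖ ^ 2 ≤ ∑ i, x i ^ 2 * ‖w i‖ ^ 2 :=
    Finset.single_le_sum (f := fun i => x i ^ 2 * ‖w i‖ ^ 2) (fun i _ => by positivity)
      (Finset.mem_univ p)
  have hmax : ∑ i, x i ^ 2 ≤ ((k₁ : ℝ) + k₂) * x p ^ 2 := by
    rw [← Finset.sum_subset (Finset.subset_univ S) fun i _ hi => by simp [hx i hi]]
    refine (Finset.sum_le_card_nsmul S _ _ hp).trans ?_
    rw [nsmul_eq_mul]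
    gcongr
    rw [hS]
    exact_mod_cast Nat.sub_le _ _
  have hpos : (0 : ℝ) < (k₁ : ℝ) + k₂ := by positivity
  calc kruskalEigenvalue A k₁ * kruskalEigenvalue B k₂ / ((k₁ : ℝ) + k₂) * ∑ i, x i ^ 2
      ≤ kruskalEigenvalue A k₁ * kruskalEigenvalue B k₂ / ((k₁ : ℝ) + k₂) *
          (((k₁ : ℝ) + k₂) * x p ^ 2) := by gcongr
    _ = kruskalEigenvalue B k₂ * (x p ^ 2 * kruskalEigenvalue A k₁) := by field_simp
    _ ≤ kruskalEigenvalue B k₂ * (x p ^ 2 * ‖w p‖ ^ 2) := by gcongr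
    _ ≤ kruskalEigenvalue B k₂ * ∑ i, x i ^ 2 * ‖w i‖ ^ 2 := by gcongr
    _ ≤ x ⬝ᵥ (Matrix.hadamard A B).mulVec x := hCB.trans hAB
end
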